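/- arXiv:1512.05940 — 2 statements merged into one kernel-verified Lean document; each statement's English description precedes it below -/
import Mathlib

section
/- Let N ∈ ℕ∖{0}, ρ1, ρ2 ≥ 1 and μ1, μ2 ∈ (0,1). Suppose ψ : [p1,p2] → ℝ satisfies Assumption (P_{ρ1,ρ2,N}) and U : (p1,p2) → ℂ satisfies Assumption (A_{μ1,μ2,N}). Then for every ω > 0, ∫_{p1}^{p2} U(p) e^{iωψ(p)} dp = Σ_{j=1,2} ( A_N^{(j)}(ω) + R_N^{(j)}(ω) ), where A_N^{(j)}(ω) := e^{iωψ(p_j)} Σ_{n=0}^{N−1} Θ_{n+1}^{(j)}(ρ_j,μ_j) (k_j)^{(n)}(0) ω^{−(n+μ_j)/ρ_j} with Θ_{n+1}^{(j)}(ρ_j,μ_j) := ((−1)^{j+1}/(n! ρ_j)) Γ((n+μ_j)/ρ_j) e^{(−1)^{j+1} iπ(n+μ_j)/(2ρ_j)}, and R_N^{(j)}(ω) := (−1)^{N+1+j} e^{iωψ(p_j)} ∫_0^{s_j} φ_N^{(j)}(s,ω,ρ_j,μ_j) (ν_j k_j)^{(N)}(s) ds; moreover |R_N^{(j)}(ω)|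 ≤ (1/(N−1)!) (1/ρ_j) Γ(N/ρ_j) (∫_0^{s_j} s^{μ_j−1} |(ν_j k_j)^{(N)}(s)| ds) ω^{−N/ρ_j} for j = 1,2. -/
open MeasureTheory Set

/-- Direction of the ray `Λ^{(j)}(s)`: `e^{(−1)^{j+1} iπ/(2ρ)}`, encoded by the sign `σ`. -/
noncomputable def edir (σ ρ : ℝ) : ℂ := Complex.exp (Complex.I * ((σ * Real.pi / (2 * ρ) : ℝ) : ℂ))

/-- `φ_N^{(j)}(s,ω,ρ,μ) := ((−1)^N/(N−1)!) ∫_{Λ^{(j)}(s)} (z−s)^{N−1} z^{μ−1}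
e^{(−1)^{j+1} iω z^ρ} dz`, the ray being parametrized by `t ↦ s + t·edir σ ρ`;
complex powers are principal branches, `σ = (−1)^{j+1}`. -/
noncomputable def phiN (σ ρ μ : ℝ) (N : ℕ) (s ω : ℝ) : ℂ :=
  ((-1 : ℂ) ^ N / (Nat.factorial (N - 1) : ℂ)) *
    ∫ t in Set.Ioi (0 : ℝ),
      ((t : ℂ) * edir σ ρ) ^ (N - 1) *
        (((s : ℂ) + (t : ℂ) * edir σ ρ) ^ ((μ - 1 : ℝ) : ℂ)) *
        Complex.exp ((σ : ℂ) * Complex.I * (ω : ℂ) * (((s : ℂ) + (t : ℂ) * edir σ ρ) ^ ((ρ : ℝ) : ℂ))) *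
        edir σ ρ

/-- `Θ_{n+1}^{(j)}(ρ,μ) := ((−1)^{j+1}/(n! ρ)) Γ((n+μ)/ρ) e^{(−1)^{j+1} iπ(n+μ)/(2ρ)}`,
with `σ = (−1)^{j+1}`. -/
noncomputable def theta (σ ρ μ : ℝ) (n : ℕ) : ℂ :=
  ((σ : ℂ) / ((Nat.factorial n : ℂ) * (ρ : ℂ))) *
    ((Real.Gamma (((n : ℝ) + μ) / ρ) : ℝ) : ℂ) *
    Complex.exp ((σ : ℂ) * Complex.I * ((Real.pi / 2 * (((n : ℝ) + μ) / ρ) : ℝ) : ℂ))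

/-- The point at parameter `t` of the ray issued from `s` in the direction `edir σ ρ`. -/
noncomputable def rayPoint (σ ρ s t : ℝ) : ℂ := (s : ℂ) + (t : ℂ) * edir σ ρ

/-- The integrand `z ^ (μ - 1) * exp (iσω z ^ ρ)`. -/
noncomputable def rayAmp (σ ρ μ ω : ℝ) (z : ℂ) : ℂ :=
  z ^ ((μ - 1 : ℝ) : ℂ) *
    Complex.exp ((σ : ℂ) * Complex.I * (ω : ℂ) * z ^ ((ρ : ℝ) : ℂ))

/-- The complex derivative of `rayAmp`. -/
noncomputable def rayAmpDeriv (σ ρ μ ω : ℝ) (z : ℂ) : ℂ :=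
  (((μ - 1 : ℝ) : ℂ) * z ^ ((μ - 2 : ℝ) : ℂ) +
      z ^ ((μ - 1 : ℝ) : ℂ) *
        ((σ : ℂ) * Complex.I * (ω : ℂ) * (((ρ : ℝ) : ℂ) * z ^ ((ρ - 1 : ℝ) : ℂ)))) *
    Complex.exp ((σ : ℂ) * Complex.I * (ω : ℂ) * z ^ ((ρ : ℝ) : ℂ))

lemma edir_eq_exp_mul_I (σ ρ : ℝ) :
    edir σ ρ = Complex.exp (((σ * Real.pi / (2 * ρ) : ℝ) : ℂ) * Complex.I) := by
  rw [edir, mul_comm]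

lemma norm_edir (σ ρ : ℝ) : ‖edir σ ρ‖ = 1 := by
  rw [edir_eq_exp_mul_I]
  exact Complex.norm_exp_ofReal_mul_I _

lemma angle_mem {ρ : ℝ} (hρ : 1 ≤ ρ) : Real.pi / (2 * ρ) ∈ Ioc 0 (Real.pi / 2) := by
  have := Real.pi_pos
  refine ⟨by positivity, ?_⟩
  gcongr
  linarith

section Ray

variable {σ ρ : ℝ}

lemma edir_re (hσ : σ = 1 ∨ σ = -1) : (edir σ ρ).re = Real.cos (Real.pi / (2 * ρ)) := by
  rw [edir_eq_exp_mul_I, Complex.exp_ofReal_mul_I_re]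
  rcases hσ with rfl | rfl
  · simp
  · rw [← Real.cos_neg]
    congr 1
    ring

lemma edir_im (hσ : σ = 1 ∨ σ = -1) : (edir σ ρ).im = σ * Real.sin (Real.pi / (2 * ρ)) := by
  rw [edir_eq_exp_mul_I, Complex.exp_ofReal_mul_I_im]
  rcases hσ with rfl | rfl
  · simp
  · rw [show (-1 : ℝ) * Real.pi / (2 * ρ) = -(Real.pi / (2 * ρ)) by ring, Real.sin_neg]
    ring

lemma cos_angle_nonneg (hρ : 1 ≤ ρ) : 0 ≤ Real.cos (Real.pi / (2 * ρ)) := by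
  have h := angle_mem hρ
  have := Real.pi_pos
  exact Real.cos_nonneg_of_neg_pi_div_two_le_of_le (by linarith [h.1]) h.2

lemma sin_angle_pos (hρ : 1 ≤ ρ) : 0 < Real.sin (Real.pi / (2 * ρ)) := by
  have h := angle_mem hρ
  have := Real.pi_pos
  exact Real.sin_pos_of_pos_of_lt_pi h.1 (by linarith [h.2])

lemma rayPoint_re (hσ : σ = 1 ∨ σ = -1) (s t : ℝ) :
    (rayPoint σ ρ s t).re = s + t * Real.cos (Real.pi / (2 * ρ)) := by
  simp [rayPoint, edir_re hσ]

lemma rayPoint_im (hσ : σ = 1 ∨ σ = -1) (s t : ℝ) :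
    (rayPoint σ ρ s t).im = t * (σ * Real.sin (Real.pi / (2 * ρ))) := by
  simp [rayPoint, edir_im hσ]

variable {s t : ℝ}

lemma le_norm_rayPoint_left (hσ : σ = 1 ∨ σ = -1) (hρ : 1 ≤ ρ) (ht : 0 ≤ t) :
    s ≤ ‖rayPoint σ ρ s t‖ := by
  refine le_trans ?_ (Complex.re_le_norm _)
  rw [rayPoint_re hσ]
  nlinarith [cos_angle_nonneg hρ]

lemma le_norm_rayPoint_right (hσ : σ = 1 ∨ σ = -1) (hρ : 1 ≤ ρ) (hs : 0 ≤ s) (ht : 0 ≤ t) :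
    t ≤ ‖rayPoint σ ρ s t‖ := by
  rw [Complex.norm_def]
  apply Real.le_sqrt_of_sq_le
  rw [Complex.normSq_apply, rayPoint_re hσ, rayPoint_im hσ]
  have h1 := cos_angle_nonneg hρ
  have h2 := Real.sin_sq_add_cos_sq (Real.pi / (2 * ρ))
  have hσ2 : σ * σ = 1 := by rcases hσ with rfl | rfl <;> norm_num
  have h3 : 0 ≤ s * t * Real.cos (Real.pi / (2 * ρ)) := by positivity
  calc t ^ 2 = t ^ 2 * (Real.sin (Real.pi / (2 * ρ)) ^ 2 + Real.cos (Real.pi / (2 * ρ)) ^ 2) := by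
        rw [h2, mul_one]
    _ ≤ s ^ 2 + 2 * (s * t * Real.cos (Real.pi / (2 * ρ))) +
        t ^ 2 * ((σ * σ) * Real.sin (Real.pi / (2 * ρ)) ^ 2 +
          Real.cos (Real.pi / (2 * ρ)) ^ 2) := by
        rw [hσ2, one_mul]
        nlinarith [sq_nonneg s]
    _ = _ := by ring

lemma norm_rayPoint_le (hs : 0 ≤ s) (ht : 0 ≤ t) : ‖rayPoint σ ρ s t‖ ≤ s + t := by
  refine (norm_add_le _ _).trans ?_
  rw [norm_mul, norm_edir, Complex.norm_real, Complex.norm_real, mul_one, Real.norm_of_nonneg hs,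
    Real.norm_of_nonneg ht]

lemma rayPoint_mem_slitPlane_of_pos_left (hσ : σ = 1 ∨ σ = -1) (hρ : 1 ≤ ρ) (hs : 0 < s)
    (ht : 0 ≤ t) : rayPoint σ ρ s t ∈ Complex.slitPlane := by
  left
  rw [rayPoint_re hσ]
  nlinarith [cos_angle_nonneg hρ]

lemma rayPoint_mem_slitPlane_of_pos_right (hσ : σ = 1 ∨ σ = -1) (hρ : 1 ≤ ρ) (ht : 0 < t) :
    rayPoint σ ρ s t ∈ Complex.slitPlane := by
  right
  rw [rayPoint_im hσ]
  have := sin_angle_pos hρ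
  rcases hσ with rfl | rfl
  · nlinarith
  · nlinarith

lemma arg_edir (hσ : σ = 1 ∨ σ = -1) (hρ : 1 ≤ ρ) :
    (edir σ ρ).arg = σ * (Real.pi / (2 * ρ)) := by
  have h := angle_mem hρ
  have := Real.pi_pos
  rw [edir_eq_exp_mul_I, Complex.arg_exp_mul_I, (toIocMod_eq_self _).2]
  · ring
  · rcases hσ with rfl | rfl
    · constructor <;> simp only [one_mul] <;> linarith [h.1, h.2]
    · rw [show (-1 : ℝ) * Real.pi / (2 * ρ) = -(Real.pi / (2 * ρ)) by ring]
      constructor <;> linarith [h.1, h.2]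

lemma arg_rayPoint_mem (hσ : σ = 1 ∨ σ = -1) (hρ : 1 ≤ ρ) (hs : 0 ≤ s) (ht : 0 < t) :
    σ * (rayPoint σ ρ s t).arg ∈ Icc 0 (Real.pi / (2 * ρ)) := by
  set z := rayPoint σ ρ s t with hz
  have hα := angle_mem hρ
  have hsin := sin_angle_pos hρ
  have hcos := cos_angle_nonneg hρ
  have hpi := Real.pi_pos
  have hn : 0 < ‖z‖ := lt_of_lt_of_le ht (le_norm_rayPoint_right hσ hρ hs ht.le)
  have hre := rayPoint_re (ρ := ρ) hσ s t
  have him := rayPoint_im (ρ := ρ) hσ s t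
  rw [← hz] at hre him
  have habs : |z.arg| ≤ Real.pi / 2 := by
    rw [Complex.abs_arg_le_pi_div_two_iff, hre]
    positivity
  rw [abs_le] at habs
  have hc := Complex.norm_mul_cos_arg z
  have hs' := Complex.norm_mul_sin_arg z
  have hdiff : ‖z‖ * Real.sin (σ * z.arg - Real.pi / (2 * ρ)) =
      -(s * Real.sin (Real.pi / (2 * ρ))) := by
    have e1 : Real.sin (σ * z.arg) = σ * Real.sin z.arg := by
      rcases hσ with rfl | rfl <;> simp
    have e2 : Real.cos (σ * z.arg) = Real.cos z.arg := by
      rcases hσ with rfl | rfl <;> simp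
    have hσ2 : σ * σ = 1 := by rcases hσ with rfl | rfl <;> norm_num
    rw [Real.sin_sub, e1, e2, mul_sub]
    rw [show ‖z‖ * (σ * Real.sin z.arg * Real.cos (Real.pi / (2 * ρ))) =
      σ * (‖z‖ * Real.sin z.arg) * Real.cos (Real.pi / (2 * ρ)) by ring, hs', him,
      ← mul_assoc ‖z‖, hc, hre]
    linear_combination t * Real.sin (Real.pi / (2 * ρ)) * Real.cos (Real.pi / (2 * ρ)) * hσ2
  have hle : σ * z.arg ≤ Real.pi / 2 ∧ -(Real.pi / 2) ≤ σ * z.arg := by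
    rcases hσ with rfl | rfl
    · constructor <;> linarith
    · constructor <;> linarith
  constructor
  · by_contra! hneg
    have h1 : Real.sin (σ * z.arg) < 0 := Real.sin_neg_of_neg_of_neg_pi_lt hneg (by linarith)
    have h2 : 0 ≤ ‖z‖ * Real.sin (σ * z.arg) := by
      have e1 : Real.sin (σ * z.arg) = σ * Real.sin z.arg := by
        rcases hσ with rfl | rfl <;> simp
      have hσ2 : σ * σ = 1 := by rcases hσ with rfl | rfl <;> norm_num
      rw [e1, show ‖z‖ * (σ * Real.sin z.arg) = σ * (‖z‖ * Real.sin z.arg) by ring, hs', him,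
        show σ * (t * (σ * Real.sin (Real.pi / (2 * ρ)))) =
          (σ * σ) * (t * Real.sin (Real.pi / (2 * ρ))) by ring, hσ2]
      positivity
    nlinarith
  · by_contra! hpos
    have h1 : 0 < Real.sin (σ * z.arg - Real.pi / (2 * ρ)) :=
      Real.sin_pos_of_pos_of_lt_pi (by linarith) (by linarith [hα.1])
    nlinarith [mul_pos hn h1, mul_nonneg hs hsin.le]

lemma hasDerivAt_rayPoint_left (s t : ℝ) :
    HasDerivAt (fun s : ℝ => rayPoint σ ρ s t) 1 s := by
  simpa [rayPoint] using (Complex.ofRealCLM.hasDerivAt (x := s)).add_const ((t : ℂ) * edir σ ρ)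

lemma hasDerivAt_rayPoint_right (s t : ℝ) :
    HasDerivAt (fun t : ℝ => rayPoint σ ρ s t) (edir σ ρ) t := by
  simpa [rayPoint] using
    ((Complex.ofRealCLM.hasDerivAt (x := t)).mul_const (edir σ ρ)).const_add (s : ℂ)

/-- On the ray, `σ * Im (z ^ ρ)` is at least the `ρ`-th power of the distance to the origin of the
ray. -/
lemma rpow_le_im_rayPoint_cpow (hσ : σ = 1 ∨ σ = -1) (hρ : 1 ≤ ρ) (hs : 0 ≤ s) (ht : 0 < t) :
    t ^ ρ ≤ σ * (rayPoint σ ρ s t ^ (ρ : ℂ)).im := by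
  have hρ0 : 0 < ρ := by linarith
  have hd : ∀ x : ℝ, HasDerivAt (fun s : ℝ => σ * (rayPoint σ ρ s t ^ (ρ : ℂ)).im)
      (σ * ((ρ : ℂ) * rayPoint σ ρ x t ^ ((ρ : ℂ) - 1)).im) x := by
    intro x
    have h1 := (Complex.hasStrictDerivAt_cpow_const (c := (ρ : ℂ))
      (rayPoint_mem_slitPlane_of_pos_right (s := x) hσ hρ ht)).hasDerivAt.comp x
      (hasDerivAt_rayPoint_left (σ := σ) (ρ := ρ) x t)
    rw [mul_one] at h1
    have h2 := (Complex.imCLM.hasFDerivAt.comp_hasDerivAt x h1).const_mul σ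
    exact h2
  have hmono : MonotoneOn (fun s : ℝ => σ * (rayPoint σ ρ s t ^ (ρ : ℂ)).im) (Ici 0) := by
    apply monotoneOn_of_deriv_nonneg (convex_Ici 0)
      (fun x _ => (hd x).continuousAt.continuousWithinAt)
      (fun x _ => (hd x).differentiableAt.differentiableWithinAt)
    intro x hx
    rw [interior_Ici] at hx
    rw [(hd x).deriv, Complex.im_ofReal_mul, show (ρ : ℂ) - 1 = ((ρ - 1 : ℝ) : ℂ) by push_cast; rfl,
      Complex.cpow_ofReal_im]
    have harg := arg_rayPoint_mem hσ hρ (le_of_lt hx) ht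
    set θ := (rayPoint σ ρ x t).arg
    have e1 : σ * Real.sin (θ * (ρ - 1)) = Real.sin (σ * θ * (ρ - 1)) := by
      rcases hσ with rfl | rfl <;> simp
    rw [show σ * (ρ * (‖rayPoint σ ρ x t‖ ^ (ρ - 1) * Real.sin (θ * (ρ - 1)))) =
      ρ * ‖rayPoint σ ρ x t‖ ^ (ρ - 1) * (σ * Real.sin (θ * (ρ - 1))) by ring, e1]
    have : 0 ≤ Real.sin (σ * θ * (ρ - 1)) := by
      apply Real.sin_nonneg_of_nonneg_of_le_pi
      · exact mul_nonneg harg.1 (by linarith)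
      · calc σ * θ * (ρ - 1) ≤ Real.pi / (2 * ρ) * ρ := by
              apply mul_le_mul harg.2 (by linarith) (by linarith) (angle_mem hρ).1.le
          _ = Real.pi / 2 := by field_simp
          _ ≤ Real.pi := by linarith [Real.pi_pos]
    positivity
  refine le_trans (le_of_eq ?_) (hmono self_mem_Ici (mem_Ici.2 hs) hs)
  have : rayPoint σ ρ 0 t = (t : ℂ) * edir σ ρ := by simp [rayPoint]
  simp only [this]
  rw [Complex.cpow_ofReal_im, Complex.arg_real_mul _ ht, arg_edir hσ hρ, norm_mul, norm_edir,
    Complex.norm_real, Real.norm_of_nonneg ht.le, mul_one,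
    show σ * (Real.pi / (2 * ρ)) * ρ = σ * (Real.pi / 2) by field_simp]
  rcases hσ with rfl | rfl <;> simp

end Ray

section RayAmp

variable {σ ρ μ ω s t : ℝ}

lemma hasDerivAt_rayAmp {z : ℂ} (hz : z ∈ Complex.slitPlane) :
    HasDerivAt (rayAmp σ ρ μ ω) (rayAmpDeriv σ ρ μ ω z) z := by
  have h (c : ℝ) : HasDerivAt (fun z : ℂ => z ^ (c : ℂ)) ((c : ℂ) * z ^ ((c - 1 : ℝ) : ℂ)) z := by
    have := (Complex.hasStrictDerivAt_cpow_const (c := (c : ℂ)) hz).hasDerivAt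
    push_cast
    exact this
  have h2 := (h (μ - 1)).mul (((h ρ).const_mul ((σ : ℂ) * Complex.I * (ω : ℂ))).cexp)
  refine h2.congr_deriv ?_
  rw [rayAmpDeriv, show μ - 1 - 1 = μ - 2 by ring]
  ring

lemma continuousAt_rayAmpDeriv {z : ℂ} (hz : z ∈ Complex.slitPlane) :
    ContinuousAt (rayAmpDeriv σ ρ μ ω) z := by
  have h (c : ℝ) : ContinuousAt (fun z : ℂ => z ^ (c : ℂ)) z := continuousAt_cpow_const hz
  have h1 := h (μ - 2)
  have h2 := h (μ - 1)
  have h3 := h (ρ - 1)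
  have h4 := h ρ
  unfold rayAmpDeriv
  fun_prop

lemma norm_cexp_phase_le (hσ : σ = 1 ∨ σ = -1) (hρ : 1 ≤ ρ) (hω : 0 < ω) (hs : 0 ≤ s)
    (ht : 0 < t) :
    ‖Complex.exp ((σ : ℂ) * Complex.I * (ω : ℂ) * rayPoint σ ρ s t ^ ((ρ : ℝ) : ℂ))‖ ≤
      Real.exp (-ω * t ^ ρ) := by
  rw [Complex.norm_exp]
  apply Real.exp_le_exp.2
  have h := rpow_le_im_rayPoint_cpow hσ hρ hs ht
  have e : ((σ : ℂ) * Complex.I * (ω : ℂ) * rayPoint σ ρ s t ^ ((ρ : ℝ) : ℂ)).re =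
      -ω * (σ * (rayPoint σ ρ s t ^ ((ρ : ℝ) : ℂ)).im) := by
    simp [Complex.mul_re, Complex.mul_im]
    ring
  rw [e]
  nlinarith

lemma norm_rayAmp_le (hσ : σ = 1 ∨ σ = -1) (hρ : 1 ≤ ρ) (hω : 0 < ω) (hs : 0 ≤ s) (ht : 0 < t) :
    ‖rayAmp σ ρ μ ω (rayPoint σ ρ s t)‖ ≤
      ‖rayPoint σ ρ s t‖ ^ (μ - 1) * Real.exp (-ω * t ^ ρ) := by
  rw [rayAmp, norm_mul, Complex.norm_cpow_real]
  gcongr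
  exact norm_cexp_phase_le hσ hρ hω hs ht

lemma norm_rayAmpDeriv_le (hσ : σ = 1 ∨ σ = -1) (hρ : 1 ≤ ρ) (hμ : μ ∈ Ioo (0 : ℝ) 1) (hω : 0 < ω)
    (hs : 0 ≤ s) (ht : 0 < t) :
    ‖rayAmpDeriv σ ρ μ ω (rayPoint σ ρ s t)‖ ≤
      (‖rayPoint σ ρ s t‖ ^ (μ - 2) +
        ‖rayPoint σ ρ s t‖ ^ (μ - 1) * (ω * (ρ * ‖rayPoint σ ρ s t‖ ^ (ρ - 1)))) *
      Real.exp (-ω * t ^ ρ) := by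
  rw [rayAmpDeriv, norm_mul]
  have hσn : ‖(σ : ℂ)‖ = 1 := by rcases hσ with rfl | rfl <;> simp
  have hμn : |μ - 1| ≤ 1 := by rw [abs_le]; constructor <;> linarith [hμ.1, hμ.2]
  gcongr
  · refine (norm_add_le _ _).trans ?_
    simp only [norm_mul, Complex.norm_cpow_real, hσn, Complex.norm_I, Complex.norm_real, one_mul,
      Real.norm_of_nonneg hω.le, Real.norm_of_nonneg (zero_le_one.trans hρ), Real.norm_eq_abs]
    gcongr
    exact mul_le_of_le_one_left (by positivity) hμn
  · exact norm_cexp_phase_le hσ hρ hω hs ht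

/-- The moments `∫ (z - s) ^ n z ^ (μ - 1) exp (iσω z ^ ρ) dz` along the ray issued from `s`. -/
noncomputable def rayMoment (σ ρ μ ω : ℝ) (n : ℕ) (s : ℝ) : ℂ :=
  ∫ t in Ioi (0 : ℝ), ((t : ℂ) * edir σ ρ) ^ n * rayAmp σ ρ μ ω (rayPoint σ ρ s t) * edir σ ρ

lemma phiN_succ (n : ℕ) :
    phiN σ ρ μ (n + 1) s ω = ((-1 : ℂ) ^ (n + 1) / (n.factorial : ℂ)) * rayMoment σ ρ μ ω n s := by
  simp only [phiN, rayMoment, rayAmp, rayPoint, Nat.add_sub_cancel, mul_assoc]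

lemma continuousOn_rayMoment_integrand (hσ : σ = 1 ∨ σ = -1) (hρ : 1 ≤ ρ) (n : ℕ) (s : ℝ) :
    ContinuousOn (fun t : ℝ =>
      ((t : ℂ) * edir σ ρ) ^ n * rayAmp σ ρ μ ω (rayPoint σ ρ s t) * edir σ ρ) (Ioi 0) := by
  intro t ht
  have h1 : ContinuousAt (fun t : ℝ => rayAmp σ ρ μ ω (rayPoint σ ρ s t)) t :=
    ContinuousAt.comp (f := fun t : ℝ => rayPoint σ ρ s t)
      (hasDerivAt_rayAmp (rayPoint_mem_slitPlane_of_pos_right hσ hρ ht)).continuousAt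
      (hasDerivAt_rayPoint_right s t).continuousAt
  apply ContinuousAt.continuousWithinAt
  fun_prop

lemma continuousOn_rayMoment_deriv_integrand (hσ : σ = 1 ∨ σ = -1) (hρ : 1 ≤ ρ) (n : ℕ) (s : ℝ) :
    ContinuousOn (fun t : ℝ =>
      ((t : ℂ) * edir σ ρ) ^ n * rayAmpDeriv σ ρ μ ω (rayPoint σ ρ s t) * edir σ ρ) (Ioi 0) := by
  intro t ht
  have h1 : ContinuousAt (fun t : ℝ => rayAmpDeriv σ ρ μ ω (rayPoint σ ρ s t)) t :=
    ContinuousAt.comp (f := fun t : ℝ => rayPoint σ ρ s t)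
      (continuousAt_rayAmpDeriv (rayPoint_mem_slitPlane_of_pos_right hσ hρ ht))
      (hasDerivAt_rayPoint_right s t).continuousAt
  apply ContinuousAt.continuousWithinAt
  fun_prop

lemma norm_rayMoment_integrand (n : ℕ) (ht : 0 < t) (w : ℂ) :
    ‖((t : ℂ) * edir σ ρ) ^ n * w * edir σ ρ‖ = t ^ n * ‖w‖ := by
  rw [norm_mul, norm_mul, norm_pow, norm_mul, norm_edir, Complex.norm_real,
    Real.norm_of_nonneg ht.le, mul_one, mul_one]

lemma norm_rayMoment_integrand_le_left (hσ : σ = 1 ∨ σ = -1) (hρ : 1 ≤ ρ) (hμ : μ ∈ Ioo (0 : ℝ) 1)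
    (hω : 0 < ω) (hs : 0 < s) (ht : 0 < t) (n : ℕ) :
    ‖((t : ℂ) * edir σ ρ) ^ n * rayAmp σ ρ μ ω (rayPoint σ ρ s t) * edir σ ρ‖ ≤
      s ^ (μ - 1) * (t ^ (n : ℝ) * Real.exp (-ω * t ^ ρ)) := by
  rw [norm_rayMoment_integrand n ht, Real.rpow_natCast]
  calc t ^ n * ‖rayAmp σ ρ μ ω (rayPoint σ ρ s t)‖
      ≤ t ^ n * (‖rayPoint σ ρ s t‖ ^ (μ - 1) * Real.exp (-ω * t ^ ρ)) := by
        gcongr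
        exact norm_rayAmp_le hσ hρ hω hs.le ht
    _ ≤ t ^ n * (s ^ (μ - 1) * Real.exp (-ω * t ^ ρ)) := by
        gcongr 2
        have := Real.rpow_le_rpow_of_nonpos hs (le_norm_rayPoint_left hσ hρ ht.le)
          (by linarith [hμ.2] : μ - 1 ≤ 0)
        gcongr
    _ = _ := by ring

lemma norm_rayMoment_integrand_le_right (hσ : σ = 1 ∨ σ = -1) (hρ : 1 ≤ ρ)
    (hμ : μ ∈ Ioo (0 : ℝ) 1) (hω : 0 < ω) (hs : 0 ≤ s) (ht : 0 < t) (n : ℕ) :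
    ‖((t : ℂ) * edir σ ρ) ^ n * rayAmp σ ρ μ ω (rayPoint σ ρ s t) * edir σ ρ‖ ≤
      t ^ ((n : ℝ) + μ - 1) * Real.exp (-ω * t ^ ρ) := by
  rw [norm_rayMoment_integrand n ht]
  calc t ^ n * ‖rayAmp σ ρ μ ω (rayPoint σ ρ s t)‖
      ≤ t ^ n * (‖rayPoint σ ρ s t‖ ^ (μ - 1) * Real.exp (-ω * t ^ ρ)) := by
        gcongr
        exact norm_rayAmp_le hσ hρ hω hs ht
    _ ≤ t ^ n * (t ^ (μ - 1) * Real.exp (-ω * t ^ ρ)) := by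
        gcongr 2
        have := Real.rpow_le_rpow_of_nonpos ht (le_norm_rayPoint_right hσ hρ hs ht.le)
          (by linarith [hμ.2] : μ - 1 ≤ 0)
        gcongr
    _ = _ := by
        rw [add_sub_assoc, Real.rpow_add ht, Real.rpow_natCast]
        ring

lemma integrableOn_rayMoment_integrand (hσ : σ = 1 ∨ σ = -1) (hρ : 1 ≤ ρ)
    (hμ : μ ∈ Ioo (0 : ℝ) 1) (hω : 0 < ω) (hs : 0 ≤ s) (n : ℕ) :
    IntegrableOn (fun t : ℝ =>
      ((t : ℂ) * edir σ ρ) ^ n * rayAmp σ ρ μ ω (rayPoint σ ρ s t) * edir σ ρ) (Ioi 0) := by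
  refine Integrable.mono' (integrableOn_rpow_mul_exp_neg_mul_rpow
    (s := (n : ℝ) + μ - 1) (p := ρ) (b := ω) ?_ (by linarith) hω)
    ((continuousOn_rayMoment_integrand hσ hρ n s).aestronglyMeasurable measurableSet_Ioi) ?_
  · have : (0 : ℝ) ≤ n := n.cast_nonneg
    linarith [hμ.1]
  · filter_upwards [self_mem_ae_restrict measurableSet_Ioi] with t ht
    exact norm_rayMoment_integrand_le_right hσ hρ hμ hω hs ht n

lemma norm_rayMoment_le (hσ : σ = 1 ∨ σ = -1) (hρ : 1 ≤ ρ)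
    (hμ : μ ∈ Ioo (0 : ℝ) 1) (hω : 0 < ω) (hs : 0 < s) (n : ℕ) :
    ‖rayMoment σ ρ μ ω n s‖ ≤ s ^ (μ - 1) *
      (ω ^ (-((n : ℝ) + 1) / ρ) * (1 / ρ) * Real.Gamma (((n : ℝ) + 1) / ρ)) := by
  have hn : (0 : ℝ) ≤ n := n.cast_nonneg
  have hρ0 : 0 < ρ := by linarith
  rw [← integral_rpow_mul_exp_neg_mul_rpow hρ0 (by linarith : (-1 : ℝ) < n) hω,
    ← integral_const_mul]
  apply norm_integral_le_of_norm_le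
  · exact (integrableOn_rpow_mul_exp_neg_mul_rpow (by linarith) hρ0 hω).const_mul _
  · filter_upwards [self_mem_ae_restrict measurableSet_Ioi] with t ht
    exact norm_rayMoment_integrand_le_left hσ hρ hμ hω hs ht n

lemma continuousOn_rayMoment (hσ : σ = 1 ∨ σ = -1) (hρ : 1 ≤ ρ)
    (hμ : μ ∈ Ioo (0 : ℝ) 1) (hω : 0 < ω) (n : ℕ) :
    ContinuousOn (rayMoment σ ρ μ ω n) (Ici 0) := by
  intro s _
  refine continuousWithinAt_of_dominated (bound := fun t : ℝ =>
    t ^ ((n : ℝ) + μ - 1) * Real.exp (-ω * t ^ ρ)) ?_ ?_ ?_ ?_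
  · filter_upwards with x
    exact (continuousOn_rayMoment_integrand hσ hρ n x).aestronglyMeasurable measurableSet_Ioi
  · filter_upwards [self_mem_nhdsWithin] with x hx
    filter_upwards [self_mem_ae_restrict measurableSet_Ioi] with t ht
    exact norm_rayMoment_integrand_le_right hσ hρ hμ hω hx ht n
  · have : (0 : ℝ) ≤ n := n.cast_nonneg
    exact integrableOn_rpow_mul_exp_neg_mul_rpow (by linarith [hμ.1]) (by linarith) hω
  · filter_upwards [self_mem_ae_restrict measurableSet_Ioi] with t ht
    have h1 : ContinuousAt (fun s : ℝ => rayAmp σ ρ μ ω (rayPoint σ ρ s t)) s :=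
      ContinuousAt.comp (f := fun s : ℝ => rayPoint σ ρ s t)
        (hasDerivAt_rayAmp (rayPoint_mem_slitPlane_of_pos_right hσ hρ ht)).continuousAt
        (hasDerivAt_rayPoint_left s t).continuousAt
    apply ContinuousAt.continuousWithinAt
    fun_prop

lemma rayMoment_zero (hσ : σ = 1 ∨ σ = -1) (hρ : 1 ≤ ρ)
    (hμ : μ ∈ Ioo (0 : ℝ) 1) (hω : 0 < ω) (n : ℕ) :
    rayMoment σ ρ μ ω n 0 =
      Complex.exp ((σ : ℂ) * Complex.I * ((Real.pi / 2 * (((n : ℝ) + μ) / ρ) : ℝ) : ℂ)) *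
        ((ω ^ (-(((n : ℝ) + μ) / ρ)) * (1 / ρ) * Real.Gamma (((n : ℝ) + μ) / ρ) : ℝ) : ℂ) := by
  have hn : (0 : ℝ) ≤ n := n.cast_nonneg
  have hρ0 : 0 < ρ := by linarith
  have hI0 := integral_rpow_mul_exp_neg_mul_rpow hρ0
    (by linarith [hμ.1] : (-1 : ℝ) < (n : ℝ) + μ - 1) hω
  rw [sub_add_cancel, neg_div] at hI0
  rw [← hI0, rayMoment, ← integral_complex_ofReal, ← integral_const_mul]
  apply setIntegral_congr_fun measurableSet_Ioi
  intro t ht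
  have ht' : 0 < t := ht
  have he : rayPoint σ ρ 0 t = (t : ℂ) * edir σ ρ := by simp [rayPoint]
  have hpow (c : ℝ) : ((t : ℂ) * edir σ ρ) ^ (c : ℂ) =
      ((t ^ c : ℝ) : ℂ) * Complex.exp ((σ * (Real.pi / (2 * ρ)) * c : ℝ) * Complex.I) := by
    rw [Complex.cpow_ofReal, norm_mul, norm_edir, Complex.norm_real, Real.norm_of_nonneg ht'.le,
      mul_one, Complex.arg_real_mul _ ht', arg_edir hσ hρ, Complex.exp_mul_I, Complex.ofReal_cos,
      Complex.ofReal_sin]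
  have hphase : (σ : ℂ) * Complex.I * (ω : ℂ) * ((t : ℂ) * edir σ ρ) ^ (ρ : ℂ) =
      ((-ω * t ^ ρ : ℝ) : ℂ) := by
    rw [hpow, show σ * (Real.pi / (2 * ρ)) * ρ = σ * (Real.pi / 2) by field_simp]
    rcases hσ with rfl | rfl
    · rw [one_mul, Complex.exp_mul_I, ← Complex.ofReal_cos, ← Complex.ofReal_sin]
      simp
      linear_combination (ω : ℂ) * ((t ^ ρ : ℝ) : ℂ) * Complex.I_mul_I
    · rw [neg_one_mul, Complex.exp_mul_I, ← Complex.ofReal_cos, ← Complex.ofReal_sin]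
      simp
      linear_combination (ω : ℂ) * ((t ^ ρ : ℝ) : ℂ) * Complex.I_mul_I
  simp only [he, rayAmp]
  rw [hphase, hpow, mul_pow, edir_eq_exp_mul_I, ← Complex.exp_nat_mul, ← Complex.ofReal_exp, add_sub_assoc,
    Real.rpow_add ht', Real.rpow_natCast]
  have hρc : (ρ : ℂ) ≠ 0 := Complex.ofReal_ne_zero.2 hρ0.ne'
  have hexp : Complex.exp ((σ : ℂ) * Complex.I * ((Real.pi / 2 * (((n : ℝ) + μ) / ρ) : ℝ) : ℂ)) =
      Complex.exp ((n : ℂ) * (((σ * Real.pi / (2 * ρ) : ℝ) : ℂ) * Complex.I)) *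
        Complex.exp ((σ * (Real.pi / (2 * ρ)) * (μ - 1) : ℝ) * Complex.I) *
        Complex.exp (((σ * Real.pi / (2 * ρ) : ℝ) : ℂ) * Complex.I) := by
    rw [← Complex.exp_add, ← Complex.exp_add]
    congr 1
    push_cast
    field_simp
    ring
  rw [hexp]
  push_cast
  ring

lemma hasDerivAt_rayMoment_aux (hσ : σ = 1 ∨ σ = -1) (hρ : 1 ≤ ρ)
    (hμ : μ ∈ Ioo (0 : ℝ) 1) (hω : 0 < ω) (hs : 0 < s) (n : ℕ) :
    IntegrableOn (fun t : ℝ => ((t : ℂ) * edir σ ρ) ^ n *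
        rayAmpDeriv σ ρ μ ω (rayPoint σ ρ s t) * edir σ ρ) (Ioi 0) ∧
      HasDerivAt (rayMoment σ ρ μ ω n) (∫ t in Ioi (0 : ℝ), ((t : ℂ) * edir σ ρ) ^ n *
        rayAmpDeriv σ ρ μ ω (rayPoint σ ρ s t) * edir σ ρ) s := by
  have hn : (0 : ℝ) ≤ n := n.cast_nonneg
  have hρ0 : 0 < ρ := by linarith
  set δ := s / 2 with hδ
  have hδ0 : 0 < δ := by positivity
  refine hasDerivAt_integral_of_dominated_loc_of_deriv_le (s := Ioo δ (2 * s))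
    (F := fun (x t : ℝ) => ((t : ℂ) * edir σ ρ) ^ n *
        rayAmp σ ρ μ ω (rayPoint σ ρ x t) * edir σ ρ)
    (F' := fun (x t : ℝ) => ((t : ℂ) * edir σ ρ) ^ n *
        rayAmpDeriv σ ρ μ ω (rayPoint σ ρ x t) * edir σ ρ)
    (bound := fun t : ℝ =>
      (δ ^ (μ - 2) + δ ^ (μ - 1) * (ω * (ρ * (4 * s) ^ (ρ - 1)))) *
          (t ^ (n : ℝ) * Real.exp (-ω * t ^ ρ)) +
        δ ^ (μ - 1) * (ω * (ρ * 2 ^ (ρ - 1))) *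
          (t ^ ((n : ℝ) + (ρ - 1)) * Real.exp (-ω * t ^ ρ)))
    (Ioo_mem_nhds (by linarith) (by linarith)) ?_ ?_ ?_ ?_ ?_ ?_
  · filter_upwards with x
    exact (continuousOn_rayMoment_integrand hσ hρ n x).aestronglyMeasurable measurableSet_Ioi
  · exact integrableOn_rayMoment_integrand hσ hρ hμ hω hs.le n
  · exact (continuousOn_rayMoment_deriv_integrand hσ hρ n s).aestronglyMeasurable
      measurableSet_Ioi
  · filter_upwards [self_mem_ae_restrict measurableSet_Ioi] with t ht x hx
    have ht' : 0 < t := ht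
    have hx0 : 0 < x := hδ0.trans hx.1
    rw [norm_rayMoment_integrand n ht, Real.rpow_add ht', Real.rpow_natCast]
    have hz1 : δ ≤ ‖rayPoint σ ρ x t‖ :=
      hx.1.le.trans (le_norm_rayPoint_left hσ hρ ht'.le)
    have hz2 : ‖rayPoint σ ρ x t‖ ≤ 2 * max (2 * s) t := by
      refine (norm_rayPoint_le hx0.le ht'.le).trans ?_
      linarith [hx.2, le_max_left (2 * s) t, le_max_right (2 * s) t]
    have b1 := Real.rpow_le_rpow_of_nonpos hδ0 hz1 (by linarith [hμ.2] : μ - 1 ≤ 0)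
    have b2 := Real.rpow_le_rpow_of_nonpos hδ0 hz1 (by linarith [hμ.2] : μ - 2 ≤ 0)
    have b3 : ‖rayPoint σ ρ x t‖ ^ (ρ - 1) ≤ (4 * s) ^ (ρ - 1) + 2 ^ (ρ - 1) * t ^ (ρ - 1) := by
      refine (Real.rpow_le_rpow (norm_nonneg _) hz2 (by linarith)).trans ?_
      rw [← Real.mul_rpow zero_le_two ht'.le]
      rcases max_cases (2 * s) t with ⟨h, -⟩ | ⟨h, -⟩
      · rw [h, show 2 * (2 * s) = 4 * s by ring]
        exact le_add_of_nonneg_right (by positivity)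
      · rw [h]
        exact le_add_of_nonneg_left (by positivity)
    calc t ^ n * ‖rayAmpDeriv σ ρ μ ω (rayPoint σ ρ x t)‖
        ≤ t ^ n * ((‖rayPoint σ ρ x t‖ ^ (μ - 2) +
          ‖rayPoint σ ρ x t‖ ^ (μ - 1) * (ω * (ρ * ‖rayPoint σ ρ x t‖ ^ (ρ - 1)))) *
            Real.exp (-ω * t ^ ρ)) := by
          gcongr
          exact norm_rayAmpDeriv_le hσ hρ hμ hω hx0.le ht'
      _ ≤ t ^ n * ((δ ^ (μ - 2) + δ ^ (μ - 1) *
            (ω * (ρ * ((4 * s) ^ (ρ - 1) + 2 ^ (ρ - 1) * t ^ (ρ - 1))))) *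
            Real.exp (-ω * t ^ ρ)) := by
          gcongr
      _ = _ := by ring
  · exact ((integrableOn_rpow_mul_exp_neg_mul_rpow (by linarith) hρ0 hω).const_mul _).add
      ((integrableOn_rpow_mul_exp_neg_mul_rpow (by linarith) hρ0 hω).const_mul _)
  · filter_upwards [self_mem_ae_restrict measurableSet_Ioi] with t ht x _
    have h1 := (hasDerivAt_rayAmp (σ := σ) (ρ := ρ) (μ := μ) (ω := ω)
      (rayPoint_mem_slitPlane_of_pos_right (s := x) hσ hρ ht)).comp x
      (hasDerivAt_rayPoint_left x t)
    rw [mul_one] at h1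
    exact (h1.const_mul _).mul_const _

lemma hasDerivAt_integrand_right (hσ : σ = 1 ∨ σ = -1) (hρ : 1 ≤ ρ) (ht : 0 < t) (n : ℕ) :
    HasDerivAt (fun t : ℝ => ((t : ℂ) * edir σ ρ) ^ n * rayAmp σ ρ μ ω (rayPoint σ ρ s t))
      ((n : ℂ) * (((t : ℂ) * edir σ ρ) ^ (n - 1) * rayAmp σ ρ μ ω (rayPoint σ ρ s t) * edir σ ρ) +
        ((t : ℂ) * edir σ ρ) ^ n * rayAmpDeriv σ ρ μ ω (rayPoint σ ρ s t) * edir σ ρ) t := by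
  have h1 := (hasDerivAt_rayAmp (σ := σ) (ρ := ρ) (μ := μ) (ω := ω)
      (rayPoint_mem_slitPlane_of_pos_right (s := s) hσ hρ ht)).comp t
      (hasDerivAt_rayPoint_right s t)
  have h2 := ((Complex.ofRealCLM.hasDerivAt (x := t)).mul_const (edir σ ρ)).pow n
  refine (h2.mul h1).congr_deriv ?_
  simp
  ring

lemma integral_rayAmpDeriv (hσ : σ = 1 ∨ σ = -1) (hρ : 1 ≤ ρ)
    (hμ : μ ∈ Ioo (0 : ℝ) 1) (hω : 0 < ω) (hs : 0 < s) (n : ℕ) :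
    ∫ t in Ioi (0 : ℝ), ((t : ℂ) * edir σ ρ) ^ n *
        rayAmpDeriv σ ρ μ ω (rayPoint σ ρ s t) * edir σ ρ =
      -((0 : ℂ) ^ n * rayAmp σ ρ μ ω s) - n * rayMoment σ ρ μ ω (n - 1) s := by
  have hI := (integrableOn_rayMoment_integrand hσ hρ hμ hω hs.le (n - 1)).const_mul (n : ℂ)
  have hJ := (hasDerivAt_rayMoment_aux hσ hρ hμ hω hs n).1
  have he0 : edir σ ρ ≠ 0 := by
    rw [← norm_pos_iff, norm_edir]
    exact one_pos
  have hK : IntegrableOn (fun t : ℝ =>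
      ((t : ℂ) * edir σ ρ) ^ n * rayAmp σ ρ μ ω (rayPoint σ ρ s t)) (Ioi 0) := by
    have := (integrableOn_rayMoment_integrand hσ hρ hμ hω hs.le n).mul_const (edir σ ρ)⁻¹
    refine Integrable.congr this (ae_of_all _ fun t => ?_)
    simp only [mul_assoc, mul_inv_cancel₀ he0, mul_one]
  have hd : ∀ t ∈ Ioi (0 : ℝ), _ := fun t ht =>
    hasDerivAt_integrand_right (μ := μ) (ω := ω) (s := s) hσ hρ ht n
  have hlim := tendsto_zero_of_hasDerivAt_of_integrableOn_Ioi hd (hI.add hJ) hK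
  have hcont : ContinuousWithinAt (fun t : ℝ =>
      ((t : ℂ) * edir σ ρ) ^ n * rayAmp σ ρ μ ω (rayPoint σ ρ s t)) (Ici 0) 0 := by
    have h1 : ContinuousAt (fun t : ℝ => rayAmp σ ρ μ ω (rayPoint σ ρ s t)) 0 :=
      ContinuousAt.comp (f := fun t : ℝ => rayPoint σ ρ s t)
        (hasDerivAt_rayAmp (rayPoint_mem_slitPlane_of_pos_left hσ hρ hs le_rfl)).continuousAt
        (hasDerivAt_rayPoint_right s 0).continuousAt
    apply ContinuousAt.continuousWithinAt
    fun_prop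
  have key := integral_Ioi_of_hasDerivAt_of_tendsto hcont hd (hI.add hJ) hlim
  rw [integral_add hI hJ, integral_const_mul] at key
  have e : rayPoint σ ρ s 0 = s := by simp [rayPoint]
  rw [e, Complex.ofReal_zero, zero_mul] at key
  rw [rayMoment]
  linear_combination key

lemma hasDerivAt_rayMoment_zero (hσ : σ = 1 ∨ σ = -1) (hρ : 1 ≤ ρ)
    (hμ : μ ∈ Ioo (0 : ℝ) 1) (hω : 0 < ω) (hs : 0 < s) :
    HasDerivAt (rayMoment σ ρ μ ω 0) (-rayAmp σ ρ μ ω s) s := by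
  refine (hasDerivAt_rayMoment_aux hσ hρ hμ hω hs 0).2.congr_deriv ?_
  rw [integral_rayAmpDeriv hσ hρ hμ hω hs 0]
  simp

lemma hasDerivAt_rayMoment_succ (hσ : σ = 1 ∨ σ = -1) (hρ : 1 ≤ ρ)
    (hμ : μ ∈ Ioo (0 : ℝ) 1) (hω : 0 < ω) (hs : 0 < s) (n : ℕ) :
    HasDerivAt (rayMoment σ ρ μ ω (n + 1)) (-((n + 1 : ℕ) : ℂ) * rayMoment σ ρ μ ω n s) s := by
  refine (hasDerivAt_rayMoment_aux hσ hρ hμ hω hs (n + 1)).2.congr_deriv ?_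
  rw [integral_rayAmpDeriv hσ hρ hμ hω hs (n + 1)]
  simp
  ring

end RayAmp

section Expansion

variable {σ ρ μ ω b : ℝ}

lemma continuousOn_phiN (hσ : σ = 1 ∨ σ = -1) (hρ : 1 ≤ ρ)
    (hμ : μ ∈ Ioo (0 : ℝ) 1) (hω : 0 < ω) (n : ℕ) :
    ContinuousOn (fun s => phiN σ ρ μ (n + 1) s ω) (Ici 0) := by
  simp only [phiN_succ]
  exact (continuousOn_rayMoment hσ hρ hμ hω n).const_mul _

lemma hasDerivAt_phiN_one (hσ : σ = 1 ∨ σ = -1) (hρ : 1 ≤ ρ)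
    (hμ : μ ∈ Ioo (0 : ℝ) 1) (hω : 0 < ω) {s : ℝ} (hs : 0 < s) :
    HasDerivAt (fun s => phiN σ ρ μ (0 + 1) s ω) (rayAmp σ ρ μ ω s) s := by
  simp only [phiN_succ]
  refine ((hasDerivAt_rayMoment_zero hσ hρ hμ hω hs).const_mul _).congr_deriv ?_
  simp

lemma hasDerivAt_phiN_succ (hσ : σ = 1 ∨ σ = -1) (hρ : 1 ≤ ρ)
    (hμ : μ ∈ Ioo (0 : ℝ) 1) (hω : 0 < ω) {s : ℝ} (hs : 0 < s) (n : ℕ) :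
    HasDerivAt (fun s => phiN σ ρ μ (n + 1 + 1) s ω) (phiN σ ρ μ (n + 1) s ω) s := by
  simp only [phiN_succ]
  refine ((hasDerivAt_rayMoment_succ hσ hρ hμ hω hs n).const_mul _).congr_deriv ?_
  have h1 : (n.factorial : ℂ) ≠ 0 := Nat.cast_ne_zero.2 n.factorial_ne_zero
  have h2 : ((n : ℂ) + 1) ≠ 0 := Nat.cast_add_one_ne_zero n
  rw [Nat.factorial_succ]
  push_cast
  field_simp
  ring

lemma norm_phiN_le (hσ : σ = 1 ∨ σ = -1) (hρ : 1 ≤ ρ)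
    (hμ : μ ∈ Ioo (0 : ℝ) 1) (hω : 0 < ω) {s : ℝ} (hs : 0 < s) {N : ℕ} (hN : 1 ≤ N) :
    ‖phiN σ ρ μ N s ω‖ ≤ (1 / (Nat.factorial (N - 1) : ℝ)) * (1 / ρ) * Real.Gamma ((N : ℝ) / ρ) *
      ω ^ (-(N : ℝ) / ρ) * s ^ (μ - 1) := by
  obtain ⟨n, rfl⟩ := Nat.exists_eq_add_of_le' hN
  rw [phiN_succ, norm_mul, norm_div, norm_pow, norm_neg, norm_one, one_pow, Complex.norm_natCast,
    Nat.add_sub_cancel]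
  calc 1 / (n.factorial : ℝ) * ‖rayMoment σ ρ μ ω n s‖
      ≤ 1 / (n.factorial : ℝ) * (s ^ (μ - 1) *
        (ω ^ (-((n : ℝ) + 1) / ρ) * (1 / ρ) * Real.Gamma (((n : ℝ) + 1) / ρ))) := by
        gcongr
        exact norm_rayMoment_le hσ hρ hμ hω hs n
    _ = _ := by
        push_cast
        ring

lemma intervalIntegrable_rayAmp (hμ : μ ∈ Ioo (0 : ℝ) 1) (hb : 0 ≤ b) :
    IntervalIntegrable (fun s : ℝ => rayAmp σ ρ μ ω s) volume 0 b := by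
  rw [intervalIntegrable_iff_integrableOn_Ioc_of_le hb]
  have h : IntegrableOn (fun s : ℝ => s ^ (μ - 1)) (Ioc 0 b) := by
    rw [← intervalIntegrable_iff_integrableOn_Ioc_of_le hb]
    exact intervalIntegral.intervalIntegrable_rpow' (by linarith [hμ.1])
  refine Integrable.mono' h ?_ ?_
  · apply ContinuousOn.aestronglyMeasurable _ measurableSet_Ioc
    intro s hs
    have : (s : ℂ) ∈ Complex.slitPlane := Complex.ofReal_mem_slitPlane.2 hs.1
    exact (ContinuousAt.comp (f := fun s : ℝ => (s : ℂ)) (hasDerivAt_rayAmp this).continuousAt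
      Complex.continuous_ofReal.continuousAt).continuousWithinAt
  · filter_upwards [self_mem_ae_restrict measurableSet_Ioc] with s hs
    rw [rayAmp, norm_mul, Complex.norm_cpow_real, Complex.norm_real, Real.norm_of_nonneg hs.1.le,
      ← Complex.ofReal_cpow hs.1.le, Complex.norm_exp]
    simp [Complex.mul_re]

variable {f : ℝ → ℂ} {N : ℕ}

lemma hasDerivWithinAt_iteratedDerivWithin_Icc (hb : 0 < b) (hf : ContDiffOn ℝ N f (Icc 0 b))
    {m : ℕ} (hm : m < N) {x : ℝ} (hx : x ∈ Icc 0 b) :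
    HasDerivWithinAt (iteratedDerivWithin m f (Icc 0 b))
      (iteratedDerivWithin (m + 1) f (Icc 0 b) x) (Icc 0 b) x := by
  rw [iteratedDerivWithin_succ]
  exact (hf.differentiableOn_iteratedDerivWithin (by exact_mod_cast hm)
    (uniqueDiffOn_Icc hb) x hx).hasDerivWithinAt

lemma integral_iteratedDerivWithin_mul_deriv (hb : 0 < b) (hf : ContDiffOn ℝ N f (Icc 0 b))
    {m : ℕ} (hm : m < N) (hvan : iteratedDerivWithin m f (Icc 0 b) b = 0) {v v' : ℝ → ℂ}
    (hv : ContinuousOn v (Ici 0)) (hv' : ∀ x, 0 < x → HasDerivAt v (v' x) x)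
    (hI0 : IntervalIntegrable v' volume 0 b) :
    ∫ s in (0 : ℝ)..b, v' s * iteratedDerivWithin m f (Icc 0 b) s =
      -(v 0 * iteratedDerivWithin m f (Icc 0 b) 0) -
        ∫ s in (0 : ℝ)..b, v s * iteratedDerivWithin (m + 1) f (Icc 0 b) s := by
  have hcont (k : ℕ) (hk : k ≤ N) : ContinuousOn (iteratedDerivWithin k f (Icc 0 b)) (Icc 0 b) :=
    hf.continuousOn_iteratedDerivWithin (by exact_mod_cast hk) (uniqueDiffOn_Icc hb)
  have key := intervalIntegral.integral_mul_deriv_eq_deriv_mul_of_hasDeriv_right (a := 0) (b := b)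
    (u := iteratedDerivWithin m f (Icc 0 b)) (v := v)
    (u' := iteratedDerivWithin (m + 1) f (Icc 0 b)) (v' := v') ?_ ?_ ?_ ?_ ?_ hI0
  · rw [hvan, zero_mul, zero_sub] at key
    simp only [mul_comm (v' _), mul_comm (v _)]
    exact key
  · rw [uIcc_of_le hb.le]
    exact hcont m hm.le
  · rw [uIcc_of_le hb.le]
    exact hv.mono Icc_subset_Ici_self
  · intro x hx
    rw [min_eq_left hb.le, max_eq_right hb.le] at hx
    exact ((hasDerivWithinAt_iteratedDerivWithin_Icc hb hf hm (Ioo_subset_Icc_self hx)).hasDerivAt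
      (Icc_mem_nhds hx.1 hx.2)).hasDerivWithinAt
  · intro x hx
    rw [min_eq_left hb.le, max_eq_right hb.le] at hx
    exact (hv' x hx.1).hasDerivWithinAt
  · apply ContinuousOn.intervalIntegrable
    rw [uIcc_of_le hb.le]
    exact hcont (m + 1) hm

/-- Repeated integration by parts against the iterated primitives `phiN`. -/
lemma integral_rayAmp_mul_eq_sum_phiN (hσ : σ = 1 ∨ σ = -1) (hρ : 1 ≤ ρ)
    (hμ : μ ∈ Ioo (0 : ℝ) 1) (hω : 0 < ω) (hb : 0 < b) (hf : ContDiffOn ℝ N f (Icc 0 b))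
    (hvan : ∀ m < N, iteratedDerivWithin m f (Icc 0 b) b = 0) {n : ℕ} (hn : n + 1 ≤ N) :
    ∫ s in (0 : ℝ)..b, rayAmp σ ρ μ ω s * f s =
      ∑ m ∈ Finset.range (n + 1), (-1 : ℂ) ^ (m + 1) *
          (phiN σ ρ μ (m + 1) 0 ω * iteratedDerivWithin m f (Icc 0 b) 0) +
        (-1 : ℂ) ^ (n + 1) * ∫ s in (0 : ℝ)..b, phiN σ ρ μ (n + 1) s ω *
          iteratedDerivWithin (n + 1) f (Icc 0 b) s := by
  induction n with
  | zero =>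
    have h := integral_iteratedDerivWithin_mul_deriv hb hf hn (hvan 0 hn)
      (continuousOn_phiN hσ hρ hμ hω 0) (fun x hx => hasDerivAt_phiN_one hσ hρ hμ hω hx)
      (intervalIntegrable_rayAmp hμ hb.le)
    simp only [iteratedDerivWithin_zero] at h
    rw [h]
    simp
    ring
  | succ n ih =>
    rw [ih (by omega), integral_iteratedDerivWithin_mul_deriv hb hf hn (hvan _ hn)
      (continuousOn_phiN hσ hρ hμ hω (n + 1))
      (fun x hx => hasDerivAt_phiN_succ hσ hρ hμ hω hx n)
      (((continuousOn_phiN hσ hρ hμ hω n).mono (by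
        rw [uIcc_of_le hb.le]; exact Icc_subset_Ici_self)).intervalIntegrable),
      Finset.sum_range_succ _ (n + 1)]
    ring

lemma phiN_zero_eq_theta (hσ : σ = 1 ∨ σ = -1) (hρ : 1 ≤ ρ)
    (hμ : μ ∈ Ioo (0 : ℝ) 1) (hω : 0 < ω) (n : ℕ) :
    (-1 : ℂ) ^ (n + 1) * phiN σ ρ μ (n + 1) 0 ω =
      σ * theta σ ρ μ n * ((ω ^ (-(((n : ℝ) + μ) / ρ)) : ℝ) : ℂ) := by
  have hσ2 : (σ : ℂ) * σ = 1 := by rcases hσ with rfl | rfl <;> norm_num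
  have h1 : (-1 : ℂ) ^ (n + 1) * (-1 : ℂ) ^ (n + 1) = 1 := by
    rw [← mul_pow]
    norm_num
  have hf : (n.factorial : ℂ) ≠ 0 := Nat.cast_ne_zero.2 n.factorial_ne_zero
  have hρ0 : (ρ : ℂ) ≠ 0 := Complex.ofReal_ne_zero.2 (by linarith)
  rw [phiN_succ, ← mul_assoc, mul_div_assoc', h1, rayMoment_zero hσ hρ hμ hω, theta]
  rw [show (σ : ℂ) * ((σ : ℂ) / ((n.factorial : ℂ) * (ρ : ℂ)) *
      ((Real.Gamma (((n : ℝ) + μ) / ρ) : ℝ) : ℂ) *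
      Complex.exp ((σ : ℂ) * Complex.I * ((Real.pi / 2 * (((n : ℝ) + μ) / ρ) : ℝ) : ℂ))) =
    (σ * σ : ℂ) * (1 / ((n.factorial : ℂ) * (ρ : ℂ)) *
      ((Real.Gamma (((n : ℝ) + μ) / ρ) : ℝ) : ℂ) *
      Complex.exp ((σ : ℂ) * Complex.I * ((Real.pi / 2 * (((n : ℝ) + μ) / ρ) : ℝ) : ℂ))) by ring,
    hσ2]
  generalize Complex.exp _ = E
  generalize ω ^ (-(((n : ℝ) + μ) / ρ)) = w
  generalize Real.Gamma (((n : ℝ) + μ) / ρ) = G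
  push_cast
  field_simp

/-- Erdélyi's expansion of `∫ s ^ (μ - 1) f(s) exp (iσω s ^ ρ) ds` on `[0, b]`, for amplitudes
which vanish to order `N` at `b`. -/
lemma integral_rayAmp_mul_eq_sum_theta (hσ : σ = 1 ∨ σ = -1) (hρ : 1 ≤ ρ)
    (hμ : μ ∈ Ioo (0 : ℝ) 1) (hω : 0 < ω) (hb : 0 < b) (hN : 1 ≤ N)
    (hf : ContDiffOn ℝ N f (Icc 0 b))
    (hvan : ∀ m < N, iteratedDerivWithin m f (Icc 0 b) b = 0) :
    ∫ s in (0 : ℝ)..b, rayAmp σ ρ μ ω s * f s =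
      σ * ∑ n ∈ Finset.range N, theta σ ρ μ n * iteratedDerivWithin n f (Icc 0 b) 0 *
          ((ω ^ (-(((n : ℝ) + μ) / ρ)) : ℝ) : ℂ) +
        (-1 : ℂ) ^ N * ∫ s in (0 : ℝ)..b, phiN σ ρ μ N s ω *
          iteratedDerivWithin N f (Icc 0 b) s := by
  obtain ⟨n, rfl⟩ := Nat.exists_eq_add_of_le' hN
  rw [integral_rayAmp_mul_eq_sum_phiN hσ hρ hμ hω hb hf hvan le_rfl, Finset.mul_sum]
  congr 1
  refine Finset.sum_congr rfl fun m _ => ?_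
  rw [← mul_assoc, phiN_zero_eq_theta hσ hρ hμ hω]
  ring

lemma norm_integral_phiN_mul_le (hσ : σ = 1 ∨ σ = -1) (hρ : 1 ≤ ρ)
    (hμ : μ ∈ Ioo (0 : ℝ) 1) (hω : 0 < ω) (hb : 0 < b) (hN : 1 ≤ N)
    (hf : ContDiffOn ℝ N f (Icc 0 b)) :
    ‖∫ s in (0 : ℝ)..b, phiN σ ρ μ N s ω * iteratedDerivWithin N f (Icc 0 b) s‖ ≤
      (1 / (Nat.factorial (N - 1) : ℝ)) * (1 / ρ) * Real.Gamma ((N : ℝ) / ρ) *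
        (∫ s in (0 : ℝ)..b, s ^ (μ - 1) * ‖iteratedDerivWithin N f (Icc 0 b) s‖) *
        ω ^ (-(N : ℝ) / ρ) := by
  rw [mul_right_comm, ← intervalIntegral.integral_const_mul]
  apply intervalIntegral.norm_integral_le_of_norm_le hb.le
  · refine ae_of_all _ fun s hs => ?_
    rw [norm_mul, ← mul_assoc]
    gcongr
    exact norm_phiN_le hσ hρ hμ hω hs.1 hN
  · apply IntervalIntegrable.const_mul
    apply IntervalIntegrable.mul_continuousOn
    · exact intervalIntegral.intervalIntegrable_rpow' (by linarith [hμ.1])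
    · rw [uIcc_of_le hb.le]
      exact (hf.continuousOn_iteratedDerivWithin le_rfl (uniqueDiffOn_Icc hb)).norm

end Expansion

section Substitution

/-- A right inverse of a strictly monotone function is as smooth as that function, away from its
critical points. -/
lemma contDiffWithinAt_of_rightInverse {Φ g : ℝ → ℝ} {S T : Set ℝ} {N : ℕ} {s d : ℝ}
    (hN : 1 ≤ N) (hΦ : StrictMonoOn Φ T) (hg : ∀ x ∈ S, g x ∈ T ∧ Φ (g x) = x) (hs : s ∈ S)
    (hT : T ∈ nhds (g s)) (hsmooth : ContDiffAt ℝ N Φ (g s)) (hd : HasDerivAt Φ d (g s))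
    (hd0 : d ≠ 0) : ContDiffWithinAt ℝ N g S s := by
  have hN0 : (N : WithTop ℕ∞) ≠ 0 := by
    have : N ≠ 0 := by omega
    exact_mod_cast this
  have hd' : HasFDerivAt Φ
      ((ContinuousLinearEquiv.unitsEquivAut ℝ (Units.mk0 d hd0) : ℝ ≃L[ℝ] ℝ) : ℝ →L[ℝ] ℝ) (g s) := by
    have e : ((ContinuousLinearEquiv.unitsEquivAut ℝ (Units.mk0 d hd0) : ℝ ≃L[ℝ] ℝ) : ℝ →L[ℝ] ℝ) =
        ContinuousLinearMap.toSpanSingleton ℝ d := by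
      ext
      simp
    rw [e]
    exact hd.hasFDerivAt
  have hG := hsmooth.to_localInverse hd' hN0
  have hright := (hsmooth.hasStrictFDerivAt' hd' hN0).eventually_right_inverse
  have himage : hsmooth.localInverse hd' hN0 (Φ (g s)) = g s :=
    hsmooth.localInverse_apply_image hd' hN0
  have hmem : ∀ᶠ x in nhds (Φ (g s)), hsmooth.localInverse hd' hN0 x ∈ T := by
    apply hG.continuousAt
    rwa [himage]
  rw [(hg s hs).2] at hG hright hmem
  refine hG.contDiffWithinAt.congr_of_eventuallyEq_of_mem ?_ hs
  filter_upwards [self_mem_nhdsWithin, nhdsWithin_le_nhds hright, nhdsWithin_le_nhds hmem]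
    with x hx h1 h2
  apply hΦ.injOn (hg x hx).1 h2
  rw [(hg x hx).2]
  exact h1.symm

/-- `g` inverts the substitution `p ↦ (ψ p - ψ a) ^ (1 / ρ)` on `[a, q]`. -/
structure IsPhaseInverse (a q b ρ s₁ : ℝ) (N : ℕ) (ψ g : ℝ → ℝ) : Prop where
  one_le_exponent : 1 ≤ ρ
  one_le_order : 1 ≤ N
  left_lt : a < q
  lt_right : q < b
  continuousOn : ContinuousOn ψ (Icc a b)
  contDiffOn : ContDiffOn ℝ N ψ (Ioo a b)
  deriv_pos : ∀ p ∈ Ioo a b, 0 < deriv ψ p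
  endpoint_eq : s₁ = (ψ q - ψ a) ^ (1 / ρ)
  mapsTo : ∀ s ∈ Icc 0 s₁, g s ∈ Icc a q
  right_inv : ∀ s ∈ Icc 0 s₁, (ψ (g s) - ψ a) ^ (1 / ρ) = s

namespace IsPhaseInverse

variable {a q b ρ s₁ : ℝ} {N : ℕ} {ψ g : ℝ → ℝ}

lemma exponent_pos (h : IsPhaseInverse a q b ρ s₁ N ψ g) : 0 < ρ :=
  zero_lt_one.trans_le h.one_le_exponent

lemma strictMonoOn_phase (h : IsPhaseInverse a q b ρ s₁ N ψ g) : StrictMonoOn ψ (Icc a b) :=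
  strictMonoOn_of_deriv_pos (convex_Icc a b) h.continuousOn fun p hp =>
    h.deriv_pos p (by rwa [interior_Icc] at hp)

lemma phase_le (h : IsPhaseInverse a q b ρ s₁ N ψ g) {p : ℝ} (hp : p ∈ Icc a b) : ψ a ≤ ψ p :=
  h.strictMonoOn_phase.monotoneOn (left_mem_Icc.2 (h.left_lt.trans h.lt_right).le) hp hp.1

lemma strictMonoOn_root (h : IsPhaseInverse a q b ρ s₁ N ψ g) :
    StrictMonoOn (fun p => (ψ p - ψ a) ^ (1 / ρ)) (Icc a b) := by
  intro x hx y hy hxy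
  have hρ := h.exponent_pos
  exact Real.rpow_lt_rpow (sub_nonneg.2 (h.phase_le hx))
    (sub_lt_sub_right (h.strictMonoOn_phase hx hy hxy) _) (by positivity)

lemma root_left (h : IsPhaseInverse a q b ρ s₁ N ψ g) : (ψ a - ψ a) ^ (1 / ρ) = 0 := by
  have hρ := h.exponent_pos
  rw [sub_self, Real.zero_rpow (by positivity)]

lemma mem_Icc_of_mem (h : IsPhaseInverse a q b ρ s₁ N ψ g) {p : ℝ} (hp : p ∈ Icc a q) :
    p ∈ Icc a b :=
  Icc_subset_Icc_right h.lt_right.le hp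

lemma endpoint_pos (h : IsPhaseInverse a q b ρ s₁ N ψ g) : 0 < s₁ := by
  rw [h.endpoint_eq, ← h.root_left]
  exact h.strictMonoOn_root (left_mem_Icc.2 (h.left_lt.trans h.lt_right).le)
    ⟨h.left_lt.le, h.lt_right.le⟩ h.left_lt

lemma root_mem (h : IsPhaseInverse a q b ρ s₁ N ψ g) {p : ℝ} (hp : p ∈ Icc a q) :
    (ψ p - ψ a) ^ (1 / ρ) ∈ Icc 0 s₁ := by
  constructor
  · exact Real.rpow_nonneg (sub_nonneg.2 (h.phase_le (h.mem_Icc_of_mem hp))) _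
  · rw [h.endpoint_eq]
    exact h.strictMonoOn_root.monotoneOn (h.mem_Icc_of_mem hp)
      ⟨h.left_lt.le, h.lt_right.le⟩ hp.2

lemma left_inv (h : IsPhaseInverse a q b ρ s₁ N ψ g) {p : ℝ} (hp : p ∈ Icc a q) :
    g ((ψ p - ψ a) ^ (1 / ρ)) = p :=
  h.strictMonoOn_root.injOn (h.mem_Icc_of_mem (h.mapsTo _ (h.root_mem hp))) (h.mem_Icc_of_mem hp)
    (h.right_inv _ (h.root_mem hp))

lemma apply_zero (h : IsPhaseInverse a q b ρ s₁ N ψ g) : g 0 = a := by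
  have := h.left_inv (left_mem_Icc.2 h.left_lt.le)
  rwa [h.root_left] at this

lemma apply_endpoint (h : IsPhaseInverse a q b ρ s₁ N ψ g) : g s₁ = q := by
  have := h.left_inv (right_mem_Icc.2 h.left_lt.le)
  rwa [← h.endpoint_eq] at this

lemma strictMonoOn (h : IsPhaseInverse a q b ρ s₁ N ψ g) : StrictMonoOn g (Icc 0 s₁) := by
  intro x hx y hy hxy
  by_contra! hle
  have := h.strictMonoOn_root.monotoneOn (h.mem_Icc_of_mem (h.mapsTo y hy))
    (h.mem_Icc_of_mem (h.mapsTo x hx)) hle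
  simp only [h.right_inv x hx, h.right_inv y hy] at this
  linarith

lemma phase_apply (h : IsPhaseInverse a q b ρ s₁ N ψ g) {s : ℝ} (hs : s ∈ Icc 0 s₁) :
    ψ (g s) = ψ a + s ^ ρ := by
  have hρ := h.exponent_pos
  have h1 := h.right_inv s hs
  have h2 := h.phase_le (h.mem_Icc_of_mem (h.mapsTo s hs))
  have h3 : s ^ ρ = ψ (g s) - ψ a := by
    calc s ^ ρ = ((ψ (g s) - ψ a) ^ (1 / ρ)) ^ ρ := by rw [h1]
      _ = ψ (g s) - ψ a := by
        rw [← Real.rpow_mul (sub_nonneg.2 h2), one_div_mul_cancel hρ.ne', Real.rpow_one]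
  linarith

lemma image_Ioo (h : IsPhaseInverse a q b ρ s₁ N ψ g) : g '' Ioo 0 s₁ = Ioo a q := by
  have h0 := h.endpoint_pos.le
  apply Subset.antisymm
  · rintro _ ⟨s, hs, rfl⟩
    have hs' := Ioo_subset_Icc_self hs
    constructor
    · rw [← h.apply_zero]
      exact h.strictMonoOn (left_mem_Icc.2 h0) hs' hs.1
    · rw [← h.apply_endpoint]
      exact h.strictMonoOn hs' (right_mem_Icc.2 h0) hs.2
  · intro p hp
    have hp' := Ioo_subset_Icc_self hp
    refine ⟨(ψ p - ψ a) ^ (1 / ρ), ⟨?_, ?_⟩, h.left_inv hp'⟩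
    · rw [← h.root_left]
      exact h.strictMonoOn_root (h.mem_Icc_of_mem (left_mem_Icc.2 h.left_lt.le))
        (h.mem_Icc_of_mem hp') hp.1
    · rw [h.endpoint_eq]
      exact h.strictMonoOn_root (h.mem_Icc_of_mem hp')
        (h.mem_Icc_of_mem (right_mem_Icc.2 h.left_lt.le)) hp.2

lemma contDiffWithinAt (h : IsPhaseInverse a q b ρ s₁ N ψ g) {s : ℝ} (hs : s ∈ Ioc 0 s₁) :
    ContDiffWithinAt ℝ N g (Icc 0 s₁) s := by
  have hs' := Ioc_subset_Icc_self hs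
  have hρ := h.exponent_pos
  have hgs : g s ∈ Ioo a b := by
    refine ⟨?_, (h.mapsTo s hs').2.trans_lt h.lt_right⟩
    rw [← h.apply_zero]
    exact h.strictMonoOn (left_mem_Icc.2 h.endpoint_pos.le) hs' hs.1
  have hne : 0 < ψ (g s) - ψ a := sub_pos.2 (h.strictMonoOn_phase
    (left_mem_Icc.2 (h.left_lt.trans h.lt_right).le) (Ioo_subset_Icc_self hgs) hgs.1)
  have hψ : ContDiffAt ℝ N ψ (g s) := h.contDiffOn.contDiffAt (Ioo_mem_nhds hgs.1 hgs.2)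
  have hN1 : (N : WithTop ℕ∞) ≠ 0 := by
    have := h.one_le_order
    have : N ≠ 0 := by omega
    exact_mod_cast this
  have hder := ((hψ.differentiableAt hN1).hasDerivAt.sub_const (ψ a)).rpow_const
    (p := 1 / ρ) (Or.inl hne.ne')
  have hpos := h.deriv_pos _ hgs
  refine contDiffWithinAt_of_rightInverse h.one_le_order h.strictMonoOn_root
    (fun x hx => ⟨h.mem_Icc_of_mem (h.mapsTo x hx), h.right_inv x hx⟩) hs'
    (Icc_mem_nhds hgs.1 hgs.2) ?_ hder (by positivity)
  exact (hψ.sub contDiffAt_const).rpow_const_of_ne hne.ne'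

lemma hasDerivAt (h : IsPhaseInverse a q b ρ s₁ N ψ g) {s : ℝ} (hs : s ∈ Ioo 0 s₁) :
    HasDerivAt g (derivWithin g (Icc 0 s₁) s) s := by
  have hN1 : (N : WithTop ℕ∞) ≠ 0 := by
    have := h.one_le_order
    have : N ≠ 0 := by omega
    exact_mod_cast this
  exact ((h.contDiffWithinAt (Ioo_subset_Ioc_self hs)).differentiableWithinAt
    hN1).hasDerivWithinAt.hasDerivAt (Icc_mem_nhds hs.1 hs.2)

variable {c : ℝ} {ν : ℝ → ℝ} {k : ℝ → ℂ}

lemma eventually_cutoff_eq_one (h : IsPhaseInverse a q b ρ s₁ N ψ g) (hc : c ∈ Ioc a q)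
    (hν1 : ∀ p ∈ Icc a c, ν p = 1) : ∀ᶠ s in nhdsWithin 0 (Icc 0 s₁), ν (g s) = 1 := by
  have hc' := Ioc_subset_Icc_self hc
  have hpos : 0 < (ψ c - ψ a) ^ (1 / ρ) := by
    rw [← h.root_left]
    exact h.strictMonoOn_root (h.mem_Icc_of_mem (left_mem_Icc.2 h.left_lt.le))
      (h.mem_Icc_of_mem hc') hc.1
  filter_upwards [self_mem_nhdsWithin, nhdsWithin_le_nhds (Iio_mem_nhds hpos)] with s hs hs'
  apply hν1 _ ⟨(h.mapsTo s hs).1, ?_⟩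
  rw [← h.left_inv hc']
  exact h.strictMonoOn.monotoneOn hs (h.root_mem hc') (le_of_lt hs')

lemma contDiffOn_cutoff (h : IsPhaseInverse a q b ρ s₁ N ψ g) (hc : c ∈ Ioc a q)
    (hν : ContDiff ℝ (⊤ : ℕ∞) ν) (hν1 : ∀ p ∈ Icc a c, ν p = 1) :
    ContDiffOn ℝ N (fun s => ((ν (g s) : ℝ) : ℂ)) (Icc 0 s₁) := by
  have hνN : ContDiff ℝ N ν := hν.of_le (by exact_mod_cast le_top)
  intro s hs
  refine Complex.ofRealCLM.contDiff.contDiffAt.comp_contDiffWithinAt s ?_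
  rcases hs.1.eq_or_lt with rfl | hs0
  · refine contDiffWithinAt_const (c := (1 : ℝ)).congr_of_eventuallyEq_of_mem ?_ hs
    exact h.eventually_cutoff_eq_one hc hν1
  · exact hνN.contDiffAt.comp_contDiffWithinAt s (h.contDiffWithinAt ⟨hs0, hs.2⟩)

lemma iteratedDerivWithin_amplitude_zero (h : IsPhaseInverse a q b ρ s₁ N ψ g) (hc : c ∈ Ioc a q)
    (hν1 : ∀ p ∈ Icc a c, ν p = 1) (n : ℕ) :
    iteratedDerivWithin n (fun s => ((ν (g s) : ℝ) : ℂ) * k s) (Icc 0 s₁) 0 =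
      iteratedDerivWithin n k (Icc 0 s₁) 0 := by
  have he := h.eventually_cutoff_eq_one hc hν1
  apply Filter.EventuallyEq.iteratedDerivWithin_eq
  · filter_upwards [he] with s hs
    rw [hs, Complex.ofReal_one, one_mul]
  · rw [he.self_of_nhdsWithin (left_mem_Icc.2 h.endpoint_pos.le), Complex.ofReal_one, one_mul]

lemma iteratedFDerivWithin_cutoff_endpoint (h : IsPhaseInverse a q b ρ s₁ N ψ g)
    (hν : ContDiff ℝ (⊤ : ℕ∞) ν) (hν0 : ∀ p ∈ Icc q b, ν p = 0) {m : ℕ} (hm : m ≤ N) :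
    iteratedFDerivWithin ℝ m (fun s => ((ν (g s) : ℝ) : ℂ)) (Icc 0 s₁) s₁ = 0 := by
  have h0 := h.endpoint_pos
  have hhalf : s₁ / 2 < s₁ := by linarith
  have hνc : ContDiff ℝ N (fun p => ((ν p : ℝ) : ℂ)) :=
    Complex.ofRealCLM.contDiff.comp (hν.of_le (by exact_mod_cast le_top))
  have hset : (Icc 0 s₁ : Set ℝ) =ᶠ[nhds s₁] Icc (s₁ / 2) s₁ := by
    filter_upwards [Ioi_mem_nhds hhalf] with x hx
    have hx' : s₁ / 2 < x := hx
    apply propext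
    constructor
    · exact fun H => ⟨hx'.le, H.2⟩
    · exact fun H => ⟨by linarith, H.2⟩
  rw [iteratedFDerivWithin_congr_set hset, ← norm_le_zero_iff]
  have hzero : ∀ i ≤ m, ‖iteratedFDerivWithin ℝ i (fun p => ((ν p : ℝ) : ℂ)) univ (g s₁)‖ ≤ 0 := by
    intro i hi
    have hqb : q ∈ Icc q b := left_mem_Icc.2 h.lt_right.le
    rw [h.apply_endpoint, norm_le_zero_iff, iteratedFDerivWithin_univ,
      ← iteratedFDerivWithin_eq_iteratedFDeriv (uniqueDiffOn_Icc h.lt_right)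
        (hνc.contDiffAt.of_le (by exact_mod_cast hi.trans hm)) hqb,
      iteratedFDerivWithin_congr (f := fun _ => (0 : ℂ)) (fun p hp => by simp [hν0 p hp]) hqb]
    simp
  have hgs : ContDiffOn ℝ N g (Icc (s₁ / 2) s₁) := fun s hs =>
    (h.contDiffWithinAt ⟨by linarith [hs.1], hs.2⟩).mono (Icc_subset_Icc_left (by linarith))
  set D := 1 + ∑ i ∈ Finset.range (m + 1), ‖iteratedFDerivWithin ℝ i g (Icc (s₁ / 2) s₁) s₁‖
    with hD
  have hsum : 0 ≤ ∑ i ∈ Finset.range (m + 1), ‖iteratedFDerivWithin ℝ i g (Icc (s₁ / 2) s₁) s₁‖ :=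
    Finset.sum_nonneg fun _ _ => norm_nonneg _
  have key := norm_iteratedFDerivWithin_comp_le (x := s₁) (n := m) hνc.contDiffOn hgs
    (by exact_mod_cast hm) uniqueDiffOn_univ (uniqueDiffOn_Icc hhalf) (mapsTo_univ _ _)
    (right_mem_Icc.2 hhalf.le) (C := 0) (D := D) hzero ?_
  · simpa [Function.comp_def] using key
  · intro i hi him
    have h1 : ‖iteratedFDerivWithin ℝ i g (Icc (s₁ / 2) s₁) s₁‖ ≤ D := by
      have := Finset.single_le_sum (f := fun i => ‖iteratedFDerivWithin ℝ i g (Icc (s₁ / 2) s₁) s₁‖)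
        (fun _ _ => norm_nonneg _) (Finset.mem_range.2 (Nat.lt_succ_of_le him))
      linarith
    exact h1.trans (le_self_pow₀ (by linarith) (by omega))

lemma iteratedDerivWithin_amplitude_endpoint (h : IsPhaseInverse a q b ρ s₁ N ψ g)
    (hc : c ∈ Ioc a q) (hν : ContDiff ℝ (⊤ : ℕ∞) ν) (hν1 : ∀ p ∈ Icc a c, ν p = 1)
    (hν0 : ∀ p ∈ Icc q b, ν p = 0) (hk : ContDiffOn ℝ N k (Icc 0 s₁)) {m : ℕ} (hm : m ≤ N) :
    iteratedDerivWithin m (fun s => ((ν (g s) : ℝ) : ℂ) * k s) (Icc 0 s₁) s₁ = 0 := by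
  rw [← norm_le_zero_iff, ← norm_iteratedFDerivWithin_eq_norm_iteratedDerivWithin]
  refine (norm_iteratedFDerivWithin_mul_le (h.contDiffOn_cutoff hc hν hν1) hk
    (uniqueDiffOn_Icc h.endpoint_pos) (right_mem_Icc.2 h.endpoint_pos.le)
    (by exact_mod_cast hm)).trans (le_of_eq ?_)
  apply Finset.sum_eq_zero
  intro i hi
  rw [h.iteratedFDerivWithin_cutoff_endpoint hν hν0
    ((Nat.lt_succ_iff.1 (Finset.mem_range.1 hi)).trans hm)]
  simp

variable {σ μ ω : ℝ} {U : ℝ → ℂ}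

lemma integral_cutoff_eq (h : IsPhaseInverse a q b ρ s₁ N ψ g) (hν0 : ∀ p ∈ Icc q b, ν p = 0)
    (hk : ∀ s ∈ Ioc 0 s₁, k s = U (g s) * ((s ^ (1 - μ) : ℝ) : ℂ) *
      ((derivWithin g (Icc 0 s₁) s : ℝ) : ℂ)) :
    ∫ p in a..b, ((ν p : ℝ) : ℂ) * (U p * Complex.exp (Complex.I * ((ω * (σ * ψ p) : ℝ) : ℂ))) =
      Complex.exp (Complex.I * ((ω * (σ * ψ a) : ℝ) : ℂ)) *
        ∫ s in (0 : ℝ)..s₁, rayAmp σ ρ μ ω s * (((ν (g s) : ℝ) : ℂ) * k s) := by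
  rw [intervalIntegral.integral_of_le (h.left_lt.trans h.lt_right).le,
    intervalIntegral.integral_of_le h.endpoint_pos.le,
    setIntegral_eq_of_subset_of_forall_sdiff_eq_zero (s := Ioo a q) measurableSet_Ioc
      (fun p hp => ⟨hp.1, hp.2.le.trans h.lt_right.le⟩), integral_Ioc_eq_integral_Ioo,
    ← integral_const_mul, ← h.image_Ioo,
    integral_image_eq_integral_abs_deriv_smul measurableSet_Ioo
      (fun s hs => (h.hasDerivAt hs).hasDerivWithinAt)
      (h.strictMonoOn.injOn.mono Ioo_subset_Icc_self)]
  · apply setIntegral_congr_fun measurableSet_Ioo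
    intro s hs
    have hs0 : 0 < s := hs.1
    have hd : 0 ≤ derivWithin g (Icc 0 s₁) s := h.strictMonoOn.monotoneOn.derivWithin_nonneg
    have hpow : ((s ^ (μ - 1) : ℝ) : ℂ) * ((s ^ (1 - μ) : ℝ) : ℂ) = 1 := by
      rw [← Complex.ofReal_mul, ← Real.rpow_add hs0]
      simp
    have hexp : Complex.exp (Complex.I * ((ω * (σ * (ψ a + s ^ ρ)) : ℝ) : ℂ)) =
        Complex.exp (Complex.I * ((ω * (σ * ψ a) : ℝ) : ℂ)) *
          Complex.exp ((σ : ℂ) * Complex.I * (ω : ℂ) * ((s ^ ρ : ℝ) : ℂ)) := by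
      rw [← Complex.exp_add]
      congr 1
      push_cast
      ring
    simp only [rayAmp]
    rw [abs_of_nonneg hd, Complex.real_smul, h.phase_apply (Ioo_subset_Icc_self hs), hexp,
      hk s (Ioo_subset_Ioc_self hs), ← Complex.ofReal_cpow hs0.le, ← Complex.ofReal_cpow hs0.le]
    linear_combination -((derivWithin g (Icc 0 s₁) s : ℝ) : ℂ) * ((ν (g s) : ℝ) : ℂ) * U (g s) *
      Complex.exp (Complex.I * ((ω * (σ * ψ a) : ℝ) : ℂ)) *
      Complex.exp ((σ : ℂ) * Complex.I * (ω : ℂ) * ((s ^ ρ : ℝ) : ℂ)) * hpow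
  · intro p hp
    have : q ≤ p := by
      by_contra! hlt
      exact hp.2 ⟨hp.1.1, hlt⟩
    simp [hν0 p ⟨this, hp.1.2⟩]

/-- The expansion of the oscillatory integral localized near one endpoint. -/
lemma integral_cutoff_eq_sum_theta (h : IsPhaseInverse a q b ρ s₁ N ψ g)
    (hσ : σ = 1 ∨ σ = -1) (hμ : μ ∈ Ioo (0 : ℝ) 1) (hω : 0 < ω)
    (hc : c ∈ Ioc a q) (hν : ContDiff ℝ (⊤ : ℕ∞) ν) (hν1 : ∀ p ∈ Icc a c, ν p = 1)
    (hν0 : ∀ p ∈ Icc q b, ν p = 0) (hkC : ContDiffOn ℝ N k (Icc 0 s₁))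
    (hk : ∀ s ∈ Ioc 0 s₁, k s = U (g s) * ((s ^ (1 - μ) : ℝ) : ℂ) *
      ((derivWithin g (Icc 0 s₁) s : ℝ) : ℂ)) :
    ∫ p in a..b, ((ν p : ℝ) : ℂ) * (U p * Complex.exp (Complex.I * ((ω * (σ * ψ p) : ℝ) : ℂ))) =
      Complex.exp (Complex.I * ((ω * (σ * ψ a) : ℝ) : ℂ)) *
        (σ * ∑ n ∈ Finset.range N, theta σ ρ μ n * iteratedDerivWithin n k (Icc 0 s₁) 0 *
          ((ω ^ (-(((n : ℝ) + μ) / ρ)) : ℝ) : ℂ) +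
        (-1 : ℂ) ^ N * ∫ s in (0 : ℝ)..s₁, phiN σ ρ μ N s ω *
          iteratedDerivWithin N (fun s => ((ν (g s) : ℝ) : ℂ) * k s) (Icc 0 s₁) s) := by
  rw [h.integral_cutoff_eq hν0 hk, integral_rayAmp_mul_eq_sum_theta hσ h.one_le_exponent hμ hω
    h.endpoint_pos h.one_le_order ((h.contDiffOn_cutoff hc hν hν1).mul hkC)
    (fun m hm => h.iteratedDerivWithin_amplitude_endpoint hc hν hν1 hν0 hkC hm.le)]
  simp only [h.iteratedDerivWithin_amplitude_zero hc hν1]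

end IsPhaseInverse

end Substitution

section EndpointExpansion

variable {p1 p2 ρ1 ρ2 μ1 μ2 η s1 s2 ω : ℝ} {N : ℕ} {ψ ψt : ℝ → ℝ} {U ut : ℝ → ℂ}
  {g1 g2 ν : ℝ → ℝ} {k1 k2 : ℝ → ℂ}

lemma deriv_phase_eq
    (hψd : ∀ p ∈ Icc p1 p2,
      derivWithin ψ (Icc p1 p2) p = (p - p1) ^ (ρ1 - 1) * (p2 - p) ^ (ρ2 - 1) * ψt p)
    {p : ℝ} (hp : p ∈ Ioo p1 p2) :
    deriv ψ p = (p - p1) ^ (ρ1 - 1) * (p2 - p) ^ (ρ2 - 1) * ψt p := by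
  rw [← hψd p (Ioo_subset_Icc_self hp), derivWithin_of_mem_nhds (Icc_mem_nhds hp.1 hp.2)]

lemma deriv_phase_pos (hψtpos : ∀ p ∈ Icc p1 p2, 0 < ψt p)
    (hψd : ∀ p ∈ Icc p1 p2,
      derivWithin ψ (Icc p1 p2) p = (p - p1) ^ (ρ1 - 1) * (p2 - p) ^ (ρ2 - 1) * ψt p)
    {p : ℝ} (hp : p ∈ Ioo p1 p2) : 0 < deriv ψ p := by
  rw [deriv_phase_eq hψd hp]
  have h1 : 0 < p - p1 := sub_pos.2 hp.1
  have h2 : 0 < p2 - p := sub_pos.2 hp.2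
  have h3 := hψtpos p (Ioo_subset_Icc_self hp)
  positivity

lemma contDiffOn_phase (hψC1 : ContDiffOn ℝ 1 ψ (Icc p1 p2)) (hψtC : ContDiffOn ℝ N ψt (Icc p1 p2))
    (hψd : ∀ p ∈ Icc p1 p2,
      derivWithin ψ (Icc p1 p2) p = (p - p1) ^ (ρ1 - 1) * (p2 - p) ^ (ρ2 - 1) * ψt p) :
    ContDiffOn ℝ N ψ (Ioo p1 p2) := by
  suffices h : ContDiffOn ℝ (N + 1) ψ (Ioo p1 p2) from h.of_le le_self_add
  rw [contDiffOn_succ_iff_deriv_of_isOpen isOpen_Ioo]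
  refine ⟨(hψC1.differentiableOn one_ne_zero).mono Ioo_subset_Icc_self, by simp, ?_⟩
  refine ContDiffOn.congr ?_ fun p hp => deriv_phase_eq hψd hp
  refine (ContDiffOn.mul ?_ ?_).mul (hψtC.mono Ioo_subset_Icc_self)
  · exact (contDiffOn_id.sub contDiffOn_const).rpow_const_of_ne fun p hp => (sub_pos.2 hp.1).ne'
  · exact (contDiffOn_const.sub contDiffOn_id).rpow_const_of_ne fun p hp => (sub_pos.2 hp.2).ne'

lemma isPhaseInverse_left (hN : 1 ≤ N) (hρ1 : 1 ≤ ρ1)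
    (hψC1 : ContDiffOn ℝ 1 ψ (Icc p1 p2)) (hψtC : ContDiffOn ℝ N ψt (Icc p1 p2))
    (hψtpos : ∀ p ∈ Icc p1 p2, 0 < ψt p)
    (hψd : ∀ p ∈ Icc p1 p2,
      derivWithin ψ (Icc p1 p2) p = (p - p1) ^ (ρ1 - 1) * (p2 - p) ^ (ρ2 - 1) * ψt p)
    {q : ℝ} (hq : q ∈ Ioo p1 p2) (hs : s1 = (ψ q - ψ p1) ^ (1 / ρ1))
    (hm : ∀ s ∈ Icc 0 s1, g1 s ∈ Icc p1 q)
    (hr : ∀ s ∈ Icc 0 s1, (ψ (g1 s) - ψ p1) ^ (1 / ρ1) = s) :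
    IsPhaseInverse p1 q p2 ρ1 s1 N ψ g1 where
  one_le_exponent := hρ1
  one_le_order := hN
  left_lt := hq.1
  lt_right := hq.2
  continuousOn := hψC1.continuousOn
  contDiffOn := contDiffOn_phase hψC1 hψtC hψd
  deriv_pos _ hp := deriv_phase_pos hψtpos hψd hp
  endpoint_eq := hs
  mapsTo := hm
  right_inv := hr

lemma isPhaseInverse_right (hN : 1 ≤ N) (hρ2 : 1 ≤ ρ2)
    (hψC1 : ContDiffOn ℝ 1 ψ (Icc p1 p2)) (hψtC : ContDiffOn ℝ N ψt (Icc p1 p2))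
    (hψtpos : ∀ p ∈ Icc p1 p2, 0 < ψt p)
    (hψd : ∀ p ∈ Icc p1 p2,
      derivWithin ψ (Icc p1 p2) p = (p - p1) ^ (ρ1 - 1) * (p2 - p) ^ (ρ2 - 1) * ψt p)
    {q : ℝ} (hq : q ∈ Ioo p1 p2) (hs : s2 = (ψ p2 - ψ q) ^ (1 / ρ2))
    (hm : ∀ s ∈ Icc 0 s2, g2 s ∈ Icc q p2)
    (hr : ∀ s ∈ Icc 0 s2, (ψ p2 - ψ (g2 s)) ^ (1 / ρ2) = s) :
    IsPhaseInverse (-p2) (-q) (-p1) ρ2 s2 N (fun p => -ψ (-p)) (fun s => -g2 s) where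
  one_le_exponent := hρ2
  one_le_order := hN
  left_lt := neg_lt_neg hq.2
  lt_right := neg_lt_neg hq.1
  continuousOn := (hψC1.continuousOn.comp continuousOn_neg fun p hp =>
    ⟨le_neg_of_le_neg hp.2, neg_le.1 hp.1⟩).neg
  contDiffOn := ((contDiffOn_phase hψC1 hψtC hψd).comp contDiff_neg.contDiffOn fun p hp =>
    ⟨lt_neg_of_lt_neg hp.2, neg_lt.1 hp.1⟩).neg
  deriv_pos p hp := by
    have hp' : -p ∈ Ioo p1 p2 := ⟨lt_neg_of_lt_neg hp.2, neg_lt.1 hp.1⟩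
    rw [deriv.fun_neg, deriv_comp_neg, neg_neg]
    exact deriv_phase_pos hψtpos hψd hp'
  endpoint_eq := by
    rw [hs, neg_neg, neg_neg]
    ring_nf
  mapsTo s hs := ⟨neg_le_neg (hm s hs).2, neg_le_neg (hm s hs).1⟩
  right_inv s hs := by
    simp only [neg_neg]
    rw [neg_sub_neg, hr s hs]

lemma intervalIntegrable_amplitude (hp : p1 < p2) (hμ1 : 0 < μ1) (hμ2 : 0 < μ2)
    (hψ : ContinuousOn ψ (Icc p1 p2)) (hut : ContinuousOn ut (Icc p1 p2))
    (hU : ∀ p ∈ Ioo p1 p2,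
      U p = (((p - p1) ^ (μ1 - 1) * (p2 - p) ^ (μ2 - 1) : ℝ) : ℂ) * ut p) :
    IntervalIntegrable (fun p => U p * Complex.exp (Complex.I * ((ω * ψ p : ℝ) : ℂ)))
      volume p1 p2 := by
  have hC : ContinuousOn (fun p => ut p * Complex.exp (Complex.I * ((ω * ψ p : ℝ) : ℂ)))
      (Icc p1 p2) := by fun_prop
  set m := (p1 + p2) / 2 with hm
  have hm1 : p1 < m := by linarith
  have hm2 : m < p2 := by linarith
  have hleft : IntervalIntegrable (fun p => (((p - p1) ^ (μ1 - 1) : ℝ) : ℂ)) volume p1 m := by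
    have h := (intervalIntegral.intervalIntegrable_rpow' (a := 0) (b := m - p1) (r := μ1 - 1)
      (by linarith)).comp_sub_right p1
    simp only [zero_add, sub_add_cancel] at h
    exact ⟨Integrable.ofReal h.1, Integrable.ofReal h.2⟩
  have hright : IntervalIntegrable (fun p => (((p2 - p) ^ (μ2 - 1) : ℝ) : ℂ)) volume m p2 := by
    have h := (intervalIntegral.intervalIntegrable_rpow' (a := p2 - m) (b := 0) (r := μ2 - 1)
      (by linarith)).comp_sub_left p2
    simp only [sub_zero, sub_sub_cancel] at h
    exact ⟨Integrable.ofReal h.1, Integrable.ofReal h.2⟩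
  have hleft' : IntervalIntegrable (fun p => (((p2 - p) ^ (μ2 - 1) : ℝ) : ℂ) *
      (ut p * Complex.exp (Complex.I * ((ω * ψ p : ℝ) : ℂ))) * (((p - p1) ^ (μ1 - 1) : ℝ) : ℂ))
      volume p1 m := by
    refine hleft.continuousOn_mul ?_
    rw [uIcc_of_le hm1.le]
    refine ContinuousOn.mul (Complex.continuous_ofReal.comp_continuousOn ?_)
      (hC.mono (Icc_subset_Icc_right hm2.le))
    exact (continuousOn_const.sub continuousOn_id).rpow_const
      fun p hp => Or.inl (sub_pos.2 (hp.2.trans_lt hm2)).ne'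
  have hright' : IntervalIntegrable (fun p => (((p - p1) ^ (μ1 - 1) : ℝ) : ℂ) *
      (ut p * Complex.exp (Complex.I * ((ω * ψ p : ℝ) : ℂ))) * (((p2 - p) ^ (μ2 - 1) : ℝ) : ℂ))
      volume m p2 := by
    refine hright.continuousOn_mul ?_
    rw [uIcc_of_le hm2.le]
    refine ContinuousOn.mul (Complex.continuous_ofReal.comp_continuousOn ?_)
      (hC.mono (Icc_subset_Icc_left hm1.le))
    exact (continuousOn_id.sub continuousOn_const).rpow_const
      fun p hp => Or.inl (sub_pos.2 (hm1.trans_le hp.1)).ne'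
  have hall : IntervalIntegrable (fun p => (((p - p1) ^ (μ1 - 1) : ℝ) : ℂ) *
      (ut p * Complex.exp (Complex.I * ((ω * ψ p : ℝ) : ℂ))) * (((p2 - p) ^ (μ2 - 1) : ℝ) : ℂ))
      volume p1 p2 := by
    refine IntervalIntegrable.trans (b := m) ?_ hright'
    convert hleft' using 2
    ring
  rw [intervalIntegrable_iff_integrableOn_Ioo_of_le hp.le] at hall ⊢
  refine hall.congr_fun (fun p hp => ?_) measurableSet_Ioo
  simp only [hU p hp]
  push_cast
  ring

lemma integral_eq_add_integral_cutoff (hν : Continuous ν) {F : ℝ → ℂ}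
    (hF : IntervalIntegrable F volume p1 p2) :
    ∫ p in p1..p2, F p =
      (∫ p in p1..p2, ((ν p : ℝ) : ℂ) * F p) +
        ∫ p in (-p2)..(-p1), ((1 - ν (-p) : ℝ) : ℂ) * F (-p) := by
  rw [intervalIntegral.integral_comp_neg (fun p => ((1 - ν p : ℝ) : ℂ) * F p), neg_neg, neg_neg,
    ← intervalIntegral.integral_add]
  · apply intervalIntegral.integral_congr
    intro p _
    push_cast
    ring
  · exact hF.continuousOn_mul (by fun_prop)
  · exact hF.continuousOn_mul (by fun_prop)

lemma norm_remainder_le {σ ρ μ b : ℝ} {f : ℝ → ℂ} (hσ : σ = 1 ∨ σ = -1) (hρ : 1 ≤ ρ)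
    (hμ : μ ∈ Ioo (0 : ℝ) 1) (hω : 0 < ω) (hb : 0 < b) (hN : 1 ≤ N)
    (hf : ContDiffOn ℝ N f (Icc 0 b)) (m : ℕ) (x : ℝ) :
    ‖(-1 : ℂ) ^ m * Complex.exp (Complex.I * (x : ℂ)) *
        ∫ s in (0 : ℝ)..b, phiN σ ρ μ N s ω * iteratedDerivWithin N f (Icc 0 b) s‖ ≤
      (1 / (Nat.factorial (N - 1) : ℝ)) * (1 / ρ) * Real.Gamma ((N : ℝ) / ρ) *
        (∫ s in (0 : ℝ)..b, s ^ (μ - 1) * ‖iteratedDerivWithin N f (Icc 0 b) s‖) *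
        ω ^ (-(N : ℝ) / ρ) := by
  rw [norm_mul, norm_mul, norm_pow, norm_neg, norm_one, one_pow, Complex.norm_exp_I_mul_ofReal,
    one_mul, one_mul]
  exact norm_integral_phiN_mul_le hσ hρ hμ hω hb hN hf

end EndpointExpansion

/-- Theorem 1.3 (Erdélyi's expansion with remainder estimates).  Under Assumptions
(P_{ρ1,ρ2,N}) and (A_{μ1,μ2,N}) with `μ1, μ2 ∈ (0,1)`, the oscillatory integral
`∫_{p1}^{p2} U(p) e^{iωψ(p)} dp` decomposes, for any `ω > 0`, as
`Σ_{j=1,2} (A_N^{(j)}(ω) + R_N^{(j)}(ω))` with the explicit main terms `A_N^{(j)}` and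
remainders `R_N^{(j)}`, and `|R_N^{(j)}(ω)| ≤ (Γ(N/ρ_j)/((N−1)! ρ_j))
(∫_0^{s_j} s^{μ_j−1} |(ν_j k_j)^{(N)}(s)| ds) ω^{−N/ρ_j}`.  Here `φ_j` are Erdélyi's
substitutions, `g_j = φ_j⁻¹`, `k_j` the regularized amplitudes, `ν` the smooth cut-off,
`ν1 = ν∘g1`, `ν2 = (1−ν)∘g2`. -/
theorem stmt0 (p1 p2 ρ1 ρ2 μ1 μ2 η s1 s2 : ℝ) (N : ℕ)
    (ψ ψt : ℝ → ℝ) (U ut : ℝ → ℂ) (φ1 φ2 g1 g2 ν : ℝ → ℝ) (k1 k2 : ℝ → ℂ)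
    (hp : p1 < p2) (hN : 1 ≤ N)
    (hρ1 : 1 ≤ ρ1) (hρ2 : 1 ≤ ρ2)
    (hμ1 : μ1 ∈ Set.Ioo (0 : ℝ) 1) (hμ2 : μ2 ∈ Set.Ioo (0 : ℝ) 1)
    -- Assumption (P_{ρ1,ρ2,N})
    (hψC1 : ContDiffOn ℝ 1 ψ (Set.Icc p1 p2))
    (hψtC : ContDiffOn ℝ N ψt (Set.Icc p1 p2))
    (hψtpos : ∀ p ∈ Set.Icc p1 p2, 0 < ψt p)
    (hψd : ∀ p ∈ Set.Icc p1 p2,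
      derivWithin ψ (Set.Icc p1 p2) p = (p - p1) ^ (ρ1 - 1) * (p2 - p) ^ (ρ2 - 1) * ψt p)
    -- Assumption (A_{μ1,μ2,N})
    (hutC : ContDiffOn ℝ N ut (Set.Icc p1 p2))
    (hU : ∀ p ∈ Set.Ioo p1 p2,
      U p = (((p - p1) ^ (μ1 - 1) * (p2 - p) ^ (μ2 - 1) : ℝ) : ℂ) * ut p)
    (hut1 : ut p1 ≠ 0) (hut2 : ut p2 ≠ 0)
    -- the cut and the substitutions φ1, φ2 with inverses g1, g2
    (hη : η ∈ Set.Ioo (0 : ℝ) ((p2 - p1) / 2))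
    (hφ1 : ∀ p ∈ Set.Icc p1 (p2 - η), φ1 p = (ψ p - ψ p1) ^ (1 / ρ1))
    (hφ2 : ∀ p ∈ Set.Icc (p1 + η) p2, φ2 p = (ψ p2 - ψ p) ^ (1 / ρ2))
    (hs1 : s1 = φ1 (p2 - η)) (hs2 : s2 = φ2 (p1 + η))
    (hg1l : ∀ p ∈ Set.Icc p1 (p2 - η), g1 (φ1 p) = p)
    (hg1r : ∀ s ∈ Set.Icc 0 s1, φ1 (g1 s) = s)
    (hg1m : ∀ s ∈ Set.Icc 0 s1, g1 s ∈ Set.Icc p1 (p2 - η))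
    (hg2l : ∀ p ∈ Set.Icc (p1 + η) p2, g2 (φ2 p) = p)
    (hg2r : ∀ s ∈ Set.Icc 0 s2, φ2 (g2 s) = s)
    (hg2m : ∀ s ∈ Set.Icc 0 s2, g2 s ∈ Set.Icc (p1 + η) p2)
    -- the functions k1, k2 (continuously extended to the closed intervals)
    (hk1C : ContDiffOn ℝ N k1 (Set.Icc 0 s1))
    (hk2C : ContDiffOn ℝ N k2 (Set.Icc 0 s2))
    (hk1 : ∀ s ∈ Set.Ioc 0 s1,
      k1 s = U (g1 s) * ((s ^ (1 - μ1) : ℝ) : ℂ) * ((derivWithin g1 (Set.Icc 0 s1) s : ℝ) : ℂ))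
    (hk2 : ∀ s ∈ Set.Ioc 0 s2,
      k2 s = U (g2 s) * ((s ^ (1 - μ2) : ℝ) : ℂ) * ((derivWithin g2 (Set.Icc 0 s2) s : ℝ) : ℂ))
    -- the smooth cut-off ν
    (hνC : ContDiff ℝ (⊤ : ℕ∞) ν)
    (hν1 : ∀ p ∈ Set.Icc p1 (p1 + η), ν p = 1)
    (hν0 : ∀ p ∈ Set.Icc (p2 - η) p2, ν p = 0)
    (hνb : ∀ p : ℝ, ν p ∈ Set.Icc (0 : ℝ) 1)
    (ω : ℝ) (hω : 0 < ω)
    -- the main terms and remainders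
    (A1 A2 R1 R2 : ℂ)
    (hA1 : A1 = Complex.exp (Complex.I * ((ω * ψ p1 : ℝ) : ℂ)) *
      ∑ n ∈ Finset.range N, theta 1 ρ1 μ1 n * iteratedDerivWithin n k1 (Set.Icc 0 s1) 0 *
        ((ω ^ (-(((n : ℝ) + μ1) / ρ1)) : ℝ) : ℂ))
    (hA2 : A2 = Complex.exp (Complex.I * ((ω * ψ p2 : ℝ) : ℂ)) *
      ∑ n ∈ Finset.range N, theta (-1) ρ2 μ2 n * iteratedDerivWithin n k2 (Set.Icc 0 s2) 0 *
        ((ω ^ (-(((n : ℝ) + μ2) / ρ2)) : ℝ) : ℂ))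
    (hR1 : R1 = (-1 : ℂ) ^ (N + 1 + 1) * Complex.exp (Complex.I * ((ω * ψ p1 : ℝ) : ℂ)) *
      ∫ s in (0 : ℝ)..s1, phiN 1 ρ1 μ1 N s ω *
        iteratedDerivWithin N (fun s : ℝ => ((ν (g1 s) : ℝ) : ℂ) * k1 s) (Set.Icc 0 s1) s)
    (hR2 : R2 = (-1 : ℂ) ^ (N + 1 + 2) * Complex.exp (Complex.I * ((ω * ψ p2 : ℝ) : ℂ)) *
      ∫ s in (0 : ℝ)..s2, phiN (-1) ρ2 μ2 N s ω *
        iteratedDerivWithin N (fun s : ℝ => ((1 - ν (g2 s) : ℝ) : ℂ) * k2 s) (Set.Icc 0 s2) s) :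
    (∫ p in p1..p2, U p * Complex.exp (Complex.I * ((ω * ψ p : ℝ) : ℂ))) =
        (A1 + R1) + (A2 + R2) ∧
    ‖R1‖ ≤ (1 / (Nat.factorial (N - 1) : ℝ)) * (1 / ρ1) * Real.Gamma ((N : ℝ) / ρ1) *
        (∫ s in (0 : ℝ)..s1, s ^ (μ1 - 1) *
          ‖iteratedDerivWithin N (fun s : ℝ => ((ν (g1 s) : ℝ) : ℂ) * k1 s) (Set.Icc 0 s1) s‖) *
        ω ^ (-(N : ℝ) / ρ1) ∧
    ‖R2‖ ≤ (1 / (Nat.factorial (N - 1) : ℝ)) * (1 / ρ2) * Real.Gamma ((N : ℝ) / ρ2) *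
        (∫ s in (0 : ℝ)..s2, s ^ (μ2 - 1) *
          ‖iteratedDerivWithin N (fun s : ℝ => ((1 - ν (g2 s) : ℝ) : ℂ) * k2 s) (Set.Icc 0 s2) s‖) *
        ω ^ (-(N : ℝ) / ρ2) := by
  obtain ⟨hη0, hη1⟩ := hη
  have hq1 : p2 - η ∈ Ioo p1 p2 := ⟨by linarith, by linarith⟩
  have hq2 : p1 + η ∈ Ioo p1 p2 := ⟨by linarith, by linarith⟩
  have h1 : IsPhaseInverse p1 (p2 - η) p2 ρ1 s1 N ψ g1 :=
    isPhaseInverse_left hN hρ1 hψC1 hψtC hψtpos hψd hq1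
      (by rw [hs1, hφ1 _ (right_mem_Icc.2 hq1.1.le)]) hg1m
      fun s hs => by rw [← hφ1 _ (hg1m s hs), hg1r s hs]
  have h2 : IsPhaseInverse (-p2) (-(p1 + η)) (-p1) ρ2 s2 N (fun p => -ψ (-p)) (fun s => -g2 s) :=
    isPhaseInverse_right hN hρ2 hψC1 hψtC hψtpos hψd hq2
      (by rw [hs2, hφ2 _ (left_mem_Icc.2 hq2.2.le)]) hg2m
      fun s hs => by rw [← hφ2 _ (hg2m s hs), hg2r s hs]
  have hc1 : p1 + η ∈ Ioc p1 (p2 - η) := ⟨by linarith, by linarith⟩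
  have hc2 : -(p2 - η) ∈ Ioc (-p2) (-(p1 + η)) := ⟨by linarith, by linarith⟩
  have hν2C : ContDiff ℝ (⊤ : ℕ∞) fun p => 1 - ν (-p) :=
    contDiff_const.sub (hνC.comp contDiff_neg)
  have hν2one : ∀ p ∈ Icc (-p2) (-(p2 - η)), 1 - ν (-p) = 1 := fun p hp => by
    rw [hν0 _ ⟨le_neg_of_le_neg hp.2, neg_le.1 hp.1⟩, sub_zero]
  have hν2zero : ∀ p ∈ Icc (-(p1 + η)) (-p1), 1 - ν (-p) = 0 := fun p hp => by
    rw [hν1 _ ⟨le_neg_of_le_neg hp.2, neg_le.1 hp.1⟩, sub_self]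
  have hk2' : ∀ s ∈ Ioc 0 s2, -k2 s = (fun p => U (-p)) (-g2 s) * ((s ^ (1 - μ2) : ℝ) : ℂ) *
      ((derivWithin (fun s => -g2 s) (Icc 0 s2) s : ℝ) : ℂ) := fun s hs => by
    rw [derivWithin.fun_neg, hk2 s hs]
    simp
  have hf1 := (h1.contDiffOn_cutoff hc1 hνC hν1).mul hk1C
  have hf2 := (h2.contDiffOn_cutoff hc2 hν2C hν2one).mul hk2C
  simp only [neg_neg] at hf2
  have e1 := h1.integral_cutoff_eq_sum_theta (Or.inl rfl) hμ1 hω hc1 hνC hν1 hν0 hk1C hk1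
  have e2 := h2.integral_cutoff_eq_sum_theta (U := fun p => U (-p)) (Or.inr rfl) hμ2 hω hc2 hν2C hν2one hν2zero
    hk2C.neg hk2'
  refine ⟨?_, ?_, ?_⟩
  · rw [integral_eq_add_integral_cutoff hνC.continuous
      (intervalIntegrable_amplitude hp hμ1.1 hμ2.1 hψC1.continuousOn hutC.continuousOn hU)]
    simp only [one_mul, Complex.ofReal_one] at e1
    simp only [neg_neg, neg_mul, one_mul, Complex.ofReal_neg, Complex.ofReal_one,
      iteratedDerivWithin_fun_neg, mul_neg, Finset.sum_neg_distrib, intervalIntegral.integral_neg] at e2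
    rw [e1, e2, hA1, hA2, hR1, hR2]
    ring
  · rw [hR1]
    exact norm_remainder_le (Or.inl rfl) hρ1 hμ1 hω h1.endpoint_pos hN hf1 _ _
  · rw [hR2]
    exact norm_remainder_le (Or.inr rfl) hρ2 hμ2 hω h2.endpoint_pos hN hf2 _ _
end

section
/- Let N ∈ ℕ∖{0}, ρ ≥ 2, and let f : (0,∞)×(0,∞) → ℝ satisfy, for some constants a, b, c > 0 and all s, ω > 0: |f(s,ω)| ≤ a ω^{−N/ρ} and |f(s,ω)| ≤ b ω^{−(1+(N−1)/ρ)} s^{1−ρ} + c ω^{−(1+N/ρ)} s^{−ρ}. Fix γ ∈ (0,1) and set δ := (γ+N)/ρ (so δ ∈ (N/ρ, (1+N)/ρ)). Then for all s, ω > 0, |f(s,ω)| ≤ a K_ρ^γ s^{−γ} ω^{−δ}, where K_ρ is the unique positive solution of the equation a K^ρ − b K − c = 0. -/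
open Set

/-- Lemma 1.3: balance between blow-up and decay.  If `f : (0,∞)×(0,∞) → ℝ` satisfies
`|f(s,ω)| ≤ a ω^{−N/ρ}` and `|f(s,ω)| ≤ b ω^{−(1+(N−1)/ρ)} s^{1−ρ} + c ω^{−(1+N/ρ)} s^{−ρ}`
for constants `a,b,c > 0`, `N ≥ 1`, `ρ ≥ 2`, then for any `γ ∈ (0,1)`, with
`δ := (γ+N)/ρ`, one has `|f(s,ω)| ≤ a K_ρ^γ s^{−γ} ω^{−δ}` for all `s,ω > 0`, where `K_ρ`
is the unique positive solution of `a K^ρ − b K − c = 0`. -/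
theorem stmt2 (N : ℕ) (hN : 1 ≤ N) (ρ : ℝ) (hρ : 2 ≤ ρ)
    (f : ℝ → ℝ → ℝ) (a b c : ℝ) (ha : 0 < a) (hb : 0 < b) (hc : 0 < c)
    (h1 : ∀ s : ℝ, 0 < s → ∀ ω : ℝ, 0 < ω → |f s ω| ≤ a * ω ^ (-(N : ℝ) / ρ))
    (h2 : ∀ s : ℝ, 0 < s → ∀ ω : ℝ, 0 < ω →
      |f s ω| ≤ b * ω ^ (-(1 + ((N : ℝ) - 1) / ρ)) * s ^ (1 - ρ)
        + c * ω ^ (-(1 + (N : ℝ) / ρ)) * s ^ (-ρ))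
    (γ : ℝ) (hγ : γ ∈ Set.Ioo (0 : ℝ) 1)
    (K : ℝ) (hK : 0 < K) (hKroot : a * K ^ ρ - b * K - c = 0)
    (hKuniq : ∀ K' : ℝ, 0 < K' → a * K' ^ ρ - b * K' - c = 0 → K' = K) :
    ∀ s : ℝ, 0 < s → ∀ ω : ℝ, 0 < ω →
      |f s ω| ≤ a * K ^ γ * s ^ (-γ) * ω ^ (-((γ + (N : ℝ)) / ρ)) := by
  intro s hs ω hω
  have hρ0 : ρ ≠ 0 := by linarith
  obtain ⟨hγ0, hγ1⟩ := hγ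
  obtain ⟨p, hp, rfl⟩ : ∃ p : ℝ, 0 < p ∧ ω = p ^ ρ :=
    ⟨ω ^ ρ⁻¹, Real.rpow_pos_of_pos hω _, (Real.rpow_inv_rpow hω.le hρ0).symm⟩
  obtain ⟨u, hu, rfl⟩ : ∃ u : ℝ, 0 < u ∧ s = K / (u * p) :=
    ⟨K / (s * p), by positivity, by field_simp⟩
  have hdecay := h2 _ hs _ hω
  have hblowup := h1 _ hs _ hω
  have hscale (x : ℝ) : (K / (u * p)) ^ x = K ^ x * u ^ (-x) * p ^ (-x) := by
    rw [Real.div_rpow hK.le (by positivity), Real.mul_rpow hu.le hp.le, Real.rpow_neg hu.le,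
      Real.rpow_neg hp.le]
    field_simp
  have hp_pow (x : ℝ) : (p ^ ρ) ^ x = p ^ (ρ * x) := (Real.rpow_mul hp.le ρ x).symm
  have hW : 0 < p ^ (-(N : ℝ)) := Real.rpow_pos_of_pos hp _
  have htarget : a * K ^ γ * (K / (u * p)) ^ (-γ) * (p ^ ρ) ^ (-((γ + (N : ℝ)) / ρ))
      = p ^ (-(N : ℝ)) * (a * u ^ γ) := by
    rw [hscale, hp_pow, show ρ * (-((γ + (N : ℝ)) / ρ)) = -γ + -(N : ℝ) by field_simp; ring,
      Real.rpow_add hp, neg_neg, Real.rpow_neg hp.le γ, Real.rpow_neg hK.le γ]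
    have := Real.rpow_pos_of_pos hp γ
    have := Real.rpow_pos_of_pos hK γ
    field_simp
  rw [htarget]
  rcases le_total 1 u with h | h
  · rw [hp_pow, show ρ * (-(N : ℝ) / ρ) = -(N : ℝ) by field_simp] at hblowup
    have : 1 ≤ u ^ γ := Real.one_le_rpow h hγ0.le
    calc _ ≤ a * p ^ (-(N : ℝ)) := hblowup
      _ = p ^ (-(N : ℝ)) * (a * 1) := by ring
      _ ≤ _ := by gcongr
  · have hroot : a = b * K ^ (1 - ρ) + c * K ^ (-ρ) := by
      have := Real.rpow_pos_of_pos hK ρ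
      rw [Real.rpow_sub hK, Real.rpow_neg hK.le, Real.rpow_one]
      field_simp
      linarith
    have hpb : p ^ (-(N : ℝ)) = p ^ (ρ * -(1 + ((N : ℝ) - 1) / ρ)) * p ^ (-(1 - ρ)) := by
      rw [← Real.rpow_add hp]
      congr 1
      field_simp
      ring
    have hpc : p ^ (-(N : ℝ)) = p ^ (ρ * -(1 + (N : ℝ) / ρ)) * p ^ (- -ρ) := by
      rw [← Real.rpow_add hp]
      congr 1
      field_simp
      ring
    have hub : u ^ (-(1 - ρ)) ≤ u ^ γ := Real.rpow_le_rpow_of_exponent_ge hu h (by linarith)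
    have huc : u ^ (- -ρ) ≤ u ^ γ := Real.rpow_le_rpow_of_exponent_ge hu h (by linarith)
    rw [hscale, hscale, hp_pow, hp_pow] at hdecay
    calc _ ≤ _ := hdecay
      _ = b * K ^ (1 - ρ) * p ^ (-(N : ℝ)) * u ^ (-(1 - ρ))
          + c * K ^ (-ρ) * p ^ (-(N : ℝ)) * u ^ (- -ρ) := by
        nth_rewrite 1 [hpb]
        rw [hpc]
        ring
      _ ≤ b * K ^ (1 - ρ) * p ^ (-(N : ℝ)) * u ^ γ
          + c * K ^ (-ρ) * p ^ (-(N : ℝ)) * u ^ γ := by gcongr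
      _ = p ^ (-(N : ℝ)) * ((b * K ^ (1 - ρ) + c * K ^ (-ρ)) * u ^ γ) := by ring
      _ = _ := by rw [← hroot]
end
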